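/- arXiv:0705.2677 — 8 statements merged into one kernel-verified Lean document; each statement's English description precedes it below -/
import Mathlib

section
/- Let (H, ρ) be a complete separable metric space and let {P_n} and {Q_n} be two sequences of Borel probability measures on H. If ∫ f dP_n − ∫ f dQ_n → 0 as n → ∞ for every bounded uniformly continuous function f : H → ℝ, then π(P_n, Q_n) → 0, where π denotes the Lévy–Prokhorov metric. -/
open MeasureTheory Filter Topology Metric Set

lemma abs_integral_le_of_abs_le_add_indicator {α : Type*} [MeasurableSpace α]
    (μ : Measure α) [IsProbabilityMeasure μ]
    {u : α → ℝ} {N : Set α} (hN : MeasurableSet N) {a η : ℝ} (ha : 0 ≤ a)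
    (hμN : μ.real Nᶜ ≤ η) (hu : ∀ x, |u x| ≤ 1) (huN : ∀ x ∈ N, |u x| ≤ a) :
    |∫ x, u x ∂μ| ≤ a + η := by
  have hi : Integrable (Nᶜ.indicator fun _ => (1 : ℝ)) μ :=
    (integrable_const 1).indicator hN.compl
  calc |∫ x, u x ∂μ| ≤ ∫ x, (a + Nᶜ.indicator (fun _ => (1 : ℝ)) x) ∂μ := by
        rw [← Real.norm_eq_abs]
        refine norm_integral_le_of_norm_le ((integrable_const a).add hi) (ae_of_all _ fun x => ?_)
        rw [Real.norm_eq_abs]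
        by_cases hx : x ∈ N
        · simpa [hx] using huN x hx
        · simpa [hx] using (hu x).trans (by linarith)
    _ = a + μ.real Nᶜ := by
        rw [integral_add (integrable_const a) hi, integral_indicator hN.compl]
        simp
    _ ≤ a + η := by linarith

section UniformConvergence

variable {H : Type*} [MetricSpace H]

lemma uniformContinuous_of_abs_sub_le_mul_dist {f : H → ℝ} {K : ℝ}
    (hf : ∀ x y, |f x - f y| ≤ K * dist x y) : UniformContinuous f :=
  (LipschitzWith.of_dist_le' hf).uniformContinuous

/-- Soft thresholding at level `t`. -/
lemma exists_soft_threshold {t : ℝ} (ht : 0 ≤ t) :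
    ∃ v : ℝ → ℝ, (∀ a b, |v a - v b| ≤ |a - b|) ∧ (∀ a, |a| ≤ t → v a = 0) ∧
      (∀ a, |a - v a| ≤ t) ∧ (∀ a, |v a| ≤ |a|) ∧
      ∀ a c, 0 ≤ c → c ≤ 1 → |a - v a * c| ≤ |a| := by
  set v : ℝ → ℝ := fun a => a - max (-t) (min a t) with hv
  have hcases : ∀ a, a ≤ -t ∧ v a = a + t ∨ (-t ≤ a ∧ a ≤ t) ∧ v a = 0 ∨ t ≤ a ∧ v a = a - t := by
    intro a
    simp only [hv]
    rcases le_total a t with h1 | h1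
    · rw [min_eq_left h1]
      rcases le_total a (-t) with h2 | h2
      · rw [max_eq_left h2]
        exact Or.inl ⟨h2, by ring⟩
      · rw [max_eq_right h2]
        exact Or.inr (Or.inl ⟨⟨h2, h1⟩, by ring⟩)
    · rw [min_eq_right h1, max_eq_right (by linarith)]
      exact Or.inr (Or.inr ⟨h1, rfl⟩)
  have hmono : ∀ a b, a ≤ b → v a ≤ v b ∧ v b - v a ≤ b - a := by
    intro a b hab
    rcases hcases a with ⟨h1, h2⟩ | ⟨⟨h1, h1'⟩, h2⟩ | ⟨h1, h2⟩ <;>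
    rcases hcases b with ⟨h3, h4⟩ | ⟨⟨h3, h3'⟩, h4⟩ | ⟨h3, h4⟩ <;>
    constructor <;> linarith
  have hzero : ∀ a, |a| ≤ t → v a = 0 := by
    intro a ha
    rw [abs_le] at ha
    rcases hcases a with h | h | h <;> linarith [h.2]
  have hsign : ∀ a, 0 ≤ v a ∧ v a ≤ a ∨ v a ≤ 0 ∧ a ≤ v a ∨ v a = 0 := by
    intro a
    rcases hcases a with ⟨h1, h2⟩ | h | ⟨h1, h2⟩
    · exact Or.inr (Or.inl ⟨by linarith, by linarith⟩)
    · exact Or.inr (Or.inr h.2)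
    · exact Or.inl ⟨by linarith, by linarith⟩
  refine ⟨v, fun a b => ?_, hzero, fun a => ?_, fun a => ?_, fun a c hc0 hc1 => ?_⟩
  · rcases le_total a b with hab | hab
    · obtain ⟨h1, h2⟩ := hmono a b hab
      rw [abs_sub_comm, abs_sub_comm a, abs_of_nonneg (by linarith), abs_of_nonneg (by linarith)]
      exact h2
    · obtain ⟨h1, h2⟩ := hmono b a hab
      rw [abs_of_nonneg (by linarith), abs_of_nonneg (by linarith)]
      exact h2
  · rw [abs_le]
    rcases hcases a with ⟨h1, h2⟩ | ⟨⟨h1, h1'⟩, h2⟩ | ⟨h1, h2⟩ <;> constructor <;> linarith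
  · rcases hsign a with h | h | h
    · rw [abs_of_nonneg h.1, abs_of_nonneg (h.1.trans h.2)]
      exact h.2
    · rw [abs_of_nonpos h.1, abs_of_nonpos (h.2.trans h.1)]
      linarith
    · simp [h]
  · rcases hsign a with h | h | h
    · rw [abs_of_nonneg (h.1.trans h.2), abs_le]
      constructor <;> nlinarith
    · rw [abs_of_nonpos (h.2.trans h.1), abs_le]
      constructor <;> nlinarith
    · simp [h]

/-- Truncation of the scaled distance to a set. -/
lemma abs_max_zero_min_sub_infDist_div_le (E : Set H) {s c d : ℝ} (hs : 0 < s) (x y : H) :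
    |max 0 (min d (c - infDist x E / s)) - max 0 (min d (c - infDist y E / s))|
      ≤ 1 / s * dist x y := by
  calc _ ≤ |min d (c - infDist x E / s) - min d (c - infDist y E / s)| := by
        simpa using abs_max_sub_max_le_max 0 (min d (c - infDist x E / s)) 0
          (min d (c - infDist y E / s))
    _ ≤ |(c - infDist x E / s) - (c - infDist y E / s)| := by
        simpa using abs_min_sub_min_le_max d (c - infDist x E / s) d (c - infDist y E / s)
    _ = |infDist x E - infDist y E| / s := by
        rw [sub_sub_sub_cancel_left, ← sub_div, abs_div, abs_of_pos hs, abs_sub_comm]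
    _ ≤ dist x y / s := by
        gcongr
        simpa [Real.dist_eq] using (lipschitz_infDist_pt E).dist_le_mul x y
    _ = 1 / s * dist x y := by rw [one_div, inv_mul_eq_div]

/-- A bounded Lipschitz function can be cut off, in a Lipschitz way, where it is small and away
from a given set, changing it only slightly near that set. -/
lemma exists_lipschitz_cutoff {u : H → ℝ} {K : ℝ} (hu : ∀ x y, |u x - u y| ≤ K * dist x y)
    (hu1 : ∀ x, |u x| ≤ 1) {E : Set H} (hE : E.Nonempty) {s t : ℝ} (hs : 0 < s) (ht : 0 ≤ t) :
    ∃ g : H → ℝ, (∀ x, |g x| ≤ 1) ∧ (∀ x y, |g x - g y| ≤ (K + 1 / s) * dist x y) ∧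
      (∀ x, g x ≠ 0 → t < |u x| ∧ ∃ p ∈ E, dist x p < 2 * s) ∧
      (∀ x ∈ thickening s E, |u x - g x| ≤ t) ∧ ∀ x, |u x - g x| ≤ 1 := by
  obtain ⟨v, hv_lip, hv_zero, hv_near, hv_le, hv_mul⟩ := exists_soft_threshold ht
  set χ : H → ℝ := fun x => max 0 (min 1 (2 - infDist x E / s)) with hχ
  have hχ0 : ∀ x, 0 ≤ χ x := fun x => le_max_left _ _
  have hχ1 : ∀ x, χ x ≤ 1 := fun x => max_le zero_le_one (min_le_left _ _)
  have hχ_lip : ∀ x y, |χ x - χ y| ≤ 1 / s * dist x y :=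
    abs_max_zero_min_sub_infDist_div_le E hs
  refine ⟨fun x => v (u x) * χ x, fun x => ?_, fun x y => ?_, fun x hx => ⟨?_, ?_⟩,
    fun x hx => ?_,
    fun x => (hv_mul _ _ (hχ0 x) (hχ1 x)).trans (hu1 x)⟩
  · rw [abs_mul, abs_of_nonneg (hχ0 x)]
    exact mul_le_one₀ ((hv_le _).trans (hu1 x)) (hχ0 x) (hχ1 x)
  · have h1 : v (u x) * χ x - v (u y) * χ y
        = (v (u x) - v (u y)) * χ x + v (u y) * (χ x - χ y) := by ring
    rw [h1, add_mul]
    refine (abs_add_le _ _).trans (add_le_add ?_ ?_)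
    · rw [abs_mul, abs_of_nonneg (hχ0 x)]
      exact (mul_le_of_le_one_right (abs_nonneg _) (hχ1 x)).trans ((hv_lip _ _).trans (hu x y))
    · rw [abs_mul]
      exact (mul_le_of_le_one_left (abs_nonneg _) ((hv_le _).trans (hu1 y))).trans (hχ_lip x y)
  · by_contra! hcon
    exact hx (by simp [hv_zero _ hcon])
  · by_contra! hcon
    refine hx ?_
    have h1 : 2 * s ≤ infDist x E := (le_infDist hE).2 fun y hy => hcon y hy
    have h2 : 2 ≤ infDist x E / s := (le_div_iff₀ hs).2 h1
    have h3 : χ x = 0 := max_eq_left ((min_le_right _ _).trans (by linarith))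
    simp [h3]
  · have h1 : infDist x E < s := by
      obtain ⟨p, hp, hxp⟩ := mem_thickening_iff.1 hx
      exact (infDist_le_dist_of_mem hp).trans_lt hxp
    have h2 : infDist x E / s < 1 := (div_lt_one hs).2 h1
    have h3 : χ x = 1 := by
      simp only [hχ]
      rw [min_eq_left (by linarith), max_eq_right zero_le_one]
    simpa [h3] using hv_near (u x)

/-- At each point at most one member of a family with separated supports is nonzero. -/
lemma exists_forall_ne_eq_zero_of_separated {g : ℕ → H → ℝ} {δ : ℝ}
    (hsep : ∀ j k x y, j ≠ k → g j x ≠ 0 → g k y ≠ 0 → δ ≤ dist x y) (x y : H)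
    (hxy : dist x y < δ) : ∃ k, ∀ j, j ≠ k → g j x = 0 ∧ g j y = 0 := by
  by_cases hz : ∃ k, g k x ≠ 0 ∨ g k y ≠ 0
  · obtain ⟨k, hk⟩ := hz
    have hδ : 0 < δ := dist_nonneg.trans_lt hxy
    refine ⟨k, fun j hj => ⟨?_, ?_⟩⟩ <;> by_contra hne
    · rcases hk with hk | hk
      · have := hsep j k x x hj hne hk
        rw [dist_self] at this
        linarith
      · have := hsep j k x y hj hne hk
        linarith
    · rcases hk with hk | hk
      · have := hsep j k y x hj hne hk
        rw [dist_comm] at this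
        linarith
      · have := hsep j k y y hj hne hk
        rw [dist_self] at this
        linarith
  · push Not at hz
    exact ⟨0, fun j _ => hz j⟩

/-- The sum of an equi-Lipschitz family with uniformly separated supports is uniformly
continuous. -/
lemma uniformContinuous_tsum_of_separated {g : ℕ → H → ℝ} {K δ : ℝ} (hδ : 0 < δ)
    (hg : ∀ k x y, |g k x - g k y| ≤ K * dist x y)
    (hsep : ∀ j k x y, j ≠ k → g j x ≠ 0 → g k y ≠ 0 → δ ≤ dist x y) :
    UniformContinuous fun x => ∑' k, g k x := by
  rw [Metric.uniformContinuous_iff]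
  intro ε hε
  obtain ⟨r, hr, hrK⟩ : ∃ r > 0, |K| * r < ε := by
    refine ⟨ε / (|K| + 1), by positivity, ?_⟩
    rw [← mul_div_assoc, div_lt_iff₀ (by positivity)]
    nlinarith [abs_nonneg K]
  refine ⟨min δ r, lt_min hδ hr, fun x y hxy => ?_⟩
  obtain ⟨k, hk⟩ := exists_forall_ne_eq_zero_of_separated hsep x y
    (hxy.trans_le (min_le_left _ _))
  rw [tsum_eq_single k fun j hj => (hk j hj).1, tsum_eq_single k fun j hj => (hk j hj).2,
    Real.dist_eq]
  calc |g k x - g k y| ≤ K * dist x y := hg k x y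
    _ ≤ |K| * r := mul_le_mul (le_abs_self K) (hxy.le.trans (min_le_right _ _)) dist_nonneg
        (abs_nonneg K)
    _ < ε := hrK

variable [MeasurableSpace H] [BorelSpace H]

/-- In a separable space a finite measure is nearly concentrated near a finite set. -/
lemma exists_measure_compl_thickening_le [TopologicalSpace.SeparableSpace H] [Nonempty H]
    (μ : Measure H) [IsFiniteMeasure μ] {s η : ℝ} (hs : 0 < s) (hη : 0 < η) :
    ∃ E : Set H, E.Finite ∧ E.Nonempty ∧ μ.real (thickening s E)ᶜ ≤ η := by
  set d := TopologicalSpace.denseSeq H with hd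
  set A : ℕ → Set H := fun n => (thickening s (d '' Iic n))ᶜ with hA
  have hanti : Antitone A := fun m n hmn =>
    compl_subset_compl.2 (thickening_subset_of_subset _ (image_mono (Iic_subset_Iic.2 hmn)))
  have hempty : ⋂ n, A n = ∅ := by
    refine eq_empty_of_forall_notMem fun x hx => ?_
    obtain ⟨n, hy⟩ := (TopologicalSpace.denseRange_denseSeq H).exists_dist_lt x hs
    exact mem_iInter.1 hx n (mem_thickening_iff.2 ⟨_, mem_image_of_mem _ (mem_Iic.2 le_rfl), hy⟩)
  have hlim : Tendsto (fun n => μ (A n)) atTop (𝓝 0) := by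
    have := tendsto_measure_iInter_atTop (μ := μ)
      (fun n => (isOpen_thickening.measurableSet.compl (s := thickening s (d '' Iic n))
        ).nullMeasurableSet) hanti ⟨0, measure_ne_top μ _⟩
    rwa [hempty, measure_empty] at this
  obtain ⟨n, hn⟩ := (hlim.eventually (gt_mem_nhds (ENNReal.ofReal_pos.2 hη))).exists
  exact ⟨d '' Iic n, (finite_Iic n).image _, nonempty_Iic.image _,
    ENNReal.toReal_le_of_le_ofReal hη.le hn.le⟩

lemma integrable_of_uniformContinuous_of_abs_le_one (μ : Measure H) [IsProbabilityMeasure μ]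
    {u : H → ℝ} (hu : UniformContinuous u) (hu1 : ∀ x, |u x| ≤ 1) : Integrable u μ :=
  Integrable.of_bound hu.continuous.measurable.aestronglyMeasurable 1 (ae_of_all _ hu1)

/-- A gliding hump: a family of equi-Lipschitz functions with separated supports is integrated
small by the later measures and vanishes on the bulk of the earlier ones. -/
lemma exists_tsum_integral_close {P Q : ℕ → Measure H}
    [∀ n, IsProbabilityMeasure (P n)] [∀ n, IsProbabilityMeasure (Q n)]
    {g : ℕ → H → ℝ} {K δ η : ℝ} (hδ : 0 < δ) {N : ℕ → Set H} (hN : ∀ k, MeasurableSet (N k))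
    (hPN : ∀ k, (P k).real (N k)ᶜ ≤ η) (hQN : ∀ k, (Q k).real (N k)ᶜ ≤ η)
    (hg1 : ∀ k x, |g k x| ≤ 1)
    (hg : ∀ k x y, |g k x - g k y| ≤ K * dist x y)
    (hsep : ∀ j k x y, j ≠ k → g j x ≠ 0 → g k y ≠ 0 → δ ≤ dist x y)
    (hlater : ∀ j k, k < j → ∀ x ∈ N k, g j x = 0)
    (hearlier : ∀ j k, j < k → |(∫ x, g j x ∂P k) - ∫ x, g j x ∂Q k| ≤ η * (1 / 2) ^ j)
    (hη : 0 ≤ η) (k : ℕ) :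
    |(∫ x, g k x ∂P k) - ∫ x, g k x ∂Q k| ≤
      |(∫ x, ∑' j, g j x ∂P k) - ∫ x, ∑' j, g j x ∂Q k| + 4 * η := by
  have huc : UniformContinuous fun x => ∑' j, g j x :=
    uniformContinuous_tsum_of_separated hδ hg hsep
  have hpt : ∀ x, ∃ i, ∀ j, j ≠ i → g j x = 0 := fun x => by
    obtain ⟨i, hi⟩ := exists_forall_ne_eq_zero_of_separated hsep x x (by simpa using hδ)
    exact ⟨i, fun j hj => (hi j hj).1⟩
  have hsum1 : ∀ x, |∑' j, g j x| ≤ 1 := fun x => by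
    obtain ⟨i, hi⟩ := hpt x
    rw [tsum_eq_single i hi]
    exact hg1 i x
  set r : H → ℝ := fun x => (∑' j, g j x) - ∑ j ∈ Finset.range (k + 1), g j x with hr
  have hr1 : ∀ x, |r x| ≤ 1 := fun x => by
    obtain ⟨i, hi⟩ := hpt x
    simp only [hr]
    rw [tsum_eq_single i hi]
    by_cases hik : i ∈ Finset.range (k + 1)
    · rw [Finset.sum_eq_single_of_mem i hik fun j _ hj => hi j hj]
      simp
    · rw [Finset.sum_eq_zero fun j hj => hi j fun hji => hik (hji ▸ hj), sub_zero]
      exact hg1 i x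
  have hrN : ∀ x ∈ N k, |r x| ≤ 0 := fun x hx => by
    simp only [hr]
    rw [tsum_eq_sum (s := Finset.range (k + 1)), sub_self, abs_zero]
    intro j hj
    exact hlater j k (by simpa [Nat.lt_succ_iff] using hj) x hx
  have hgi : ∀ (μ : Measure H) [IsProbabilityMeasure μ] j, Integrable (g j) μ := fun μ _ j =>
    integrable_of_uniformContinuous_of_abs_le_one μ
      (uniformContinuous_of_abs_sub_le_mul_dist (hg j)) (hg1 j)
  have hsplit : ∀ (μ : Measure H) [IsProbabilityMeasure μ], ∫ x, r x ∂μ =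
      (∫ x, ∑' j, g j x ∂μ) - (∑ j ∈ Finset.range k, ∫ x, g j x ∂μ) - ∫ x, g k x ∂μ := by
    intro μ _
    simp only [hr]
    rw [integral_sub (integrable_of_uniformContinuous_of_abs_le_one μ huc hsum1)
      (integrable_finsetSum _ fun j _ => hgi μ j), integral_finsetSum _ fun j _ => hgi μ j,
      Finset.sum_range_succ]
    ring
  have hP := abs_integral_le_of_abs_le_add_indicator (P k) (hN k) le_rfl (hPN k) hr1 hrN
  have hQ := abs_integral_le_of_abs_le_add_indicator (Q k) (hN k) le_rfl (hQN k) hr1 hrN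
  have hE : |(∑ j ∈ Finset.range k, ∫ x, g j x ∂P k) - ∑ j ∈ Finset.range k, ∫ x, g j x ∂Q k|
      ≤ 2 * η := by
    rw [← Finset.sum_sub_distrib]
    calc _ ≤ ∑ j ∈ Finset.range k, η * (1 / 2) ^ j :=
          (Finset.abs_sum_le_sum_abs _ _).trans
            (Finset.sum_le_sum fun j hj => hearlier j k (Finset.mem_range.1 hj))
      _ = η * ∑ j ∈ Finset.range k, (1 / 2) ^ j := by rw [Finset.mul_sum]
      _ ≤ η * 2 := mul_le_mul_of_nonneg_left (sum_geometric_two_le k) hη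
      _ = 2 * η := mul_comm _ _
  rw [hsplit] at hP hQ
  grind

/-- If `u n → 0` pointwise along a filter, with the `u n` bounded and equi-Lipschitz, then the
differences of integrals of `u n` cannot stay away from zero. -/
lemma frequently_abs_integral_sub_lt [TopologicalSpace.SeparableSpace H]
    {P Q : ℕ → Measure H}
    [∀ n, IsProbabilityMeasure (P n)] [∀ n, IsProbabilityMeasure (Q n)]
    (h : ∀ f : H → ℝ, UniformContinuous f → (∃ C : ℝ, ∀ x, |f x| ≤ C) →
      Tendsto (fun n => (∫ x, f x ∂(P n)) - ∫ x, f x ∂(Q n)) atTop (𝓝 0))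
    {F : Filter ℕ} [F.NeBot] (hF : F ≤ atTop) {u : ℕ → H → ℝ} {K : ℝ} (hK : 0 < K)
    (hu : ∀ n x y, |u n x - u n y| ≤ K * dist x y) (hu1 : ∀ n x, |u n x| ≤ 1)
    (hlim : ∀ x, Tendsto (fun n => u n x) F (𝓝 0)) {ε : ℝ} (hε : 0 < ε) :
    ∃ᶠ n in F, |(∫ x, u n x ∂P n) - ∫ x, u n x ∂Q n| < ε := by
  intro hbig
  simp only [not_lt] at hbig
  have : Nonempty H := (P 0).nonempty_of_neZero
  set η : ℝ := ε / 24 with hηdef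
  have hη : 0 < η := by positivity
  set s : ℝ := η / (4 * K) with hsdef
  have hs : 0 < s := by positivity
  have hsK : K * (4 * s) = η := by rw [hsdef]; field_simp
  choose E hEfin hEne hEμ using fun n =>
    exists_measure_compl_thickening_le (P n + Q n) hs hη
  have hEP : ∀ n, (P n).real (thickening s (E n))ᶜ ≤ η := fun n => by
    have := hEμ n
    rw [measureReal_add_apply] at this
    linarith [measureReal_nonneg (μ := Q n) (s := (thickening s (E n))ᶜ)]
  have hEQ : ∀ n, (Q n).real (thickening s (E n))ᶜ ≤ η := fun n => by
    have := hEμ n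
    rw [measureReal_add_apply] at this
    linarith [measureReal_nonneg (μ := P n) (s := (thickening s (E n))ᶜ)]
  choose g hg1 hg hg_ne hg_near hg_sub using fun n =>
    exists_lipschitz_cutoff (hu n) (hu1 n) (hEne n) hs (mul_nonneg zero_le_two hη.le)
  have hguc : ∀ n, UniformContinuous (g n) := fun n =>
    uniformContinuous_of_abs_sub_le_mul_dist (hg n)
  have hgμ : ∀ n, Tendsto (fun k => (∫ x, g n x ∂P k) - ∫ x, g n x ∂Q k) atTop (𝓝 0) :=
    fun n => h _ (hguc n) ⟨1, hg1 n⟩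
  obtain ⟨φ, hφ, hφr⟩ := exists_seq_of_forall_finset_exists
    (fun n => ε ≤ |(∫ x, u n x ∂P n) - ∫ x, u n x ∂Q n|)
    (fun m n => m < n ∧ (∀ p ∈ E m, |u n p| ≤ η) ∧
      |(∫ x, g m x ∂P n) - ∫ x, g m x ∂Q n| ≤ η * (1 / 2) ^ m) (by
    intro T _
    have hT : ∀ m ∈ T, ∀ᶠ n in F, m < n ∧ (∀ p ∈ E m, |u n p| ≤ η) ∧
        |(∫ x, g m x ∂P n) - ∫ x, g m x ∂Q n| ≤ η * (1 / 2) ^ m := by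
      intro m _
      refine ((eventually_gt_atTop m).filter_mono hF).and (((hEfin m).eventually_all.2 fun p _ => ?_).and
        (Eventually.filter_mono hF ?_))
      · have := (hlim p).abs
        rw [abs_zero] at this
        exact this.eventually_le_const hη
      · have := (hgμ m).abs
        rw [abs_zero] at this
        exact this.eventually_le_const (by positivity)
    exact (hbig.and ((Filter.eventually_all_finset T).2 hT)).exists)
  have hmono : StrictMono φ := fun a b hab => (hφr a b hab).1
  have hfar : ∀ j k, k < j → ∀ x p, g (φ j) x ≠ 0 → p ∈ E (φ k) → 4 * s < dist x p := by
    intro j k hkj x p hx hp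
    have h1 := (hg_ne _ x hx).1
    have h2 := (hφr k j hkj).2.1 p hp
    have h3 := hu (φ j) x p
    have h4 : |u (φ j) x| ≤ |u (φ j) x - u (φ j) p| + |u (φ j) p| := by
      simpa using abs_add_le (u (φ j) x - u (φ j) p) (u (φ j) p)
    have h5 : K * (4 * s) < K * dist x p := by linarith
    exact lt_of_mul_lt_mul_left h5 hK.le
  have hsep' : ∀ j k x y, k < j → g (φ j) x ≠ 0 → g (φ k) y ≠ 0 → 2 * s ≤ dist x y := by
    intro j k x y hkj hx hy
    obtain ⟨p, hp, hyp⟩ := (hg_ne _ y hy).2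
    have h1 := hfar j k hkj x p hx hp
    linarith [dist_triangle x y p]
  have hsep : ∀ j k x y, j ≠ k → g (φ j) x ≠ 0 → g (φ k) y ≠ 0 → 2 * s ≤ dist x y := by
    intro j k x y hjk hx hy
    rcases lt_or_gt_of_ne hjk with hlt | hlt
    · rw [dist_comm]
      exact hsep' k j y x hlt hy hx
    · exact hsep' j k x y hlt hx hy
  have hclose := exists_tsum_integral_close (P := fun k => P (φ k)) (Q := fun k => Q (φ k))
    (g := fun k => g (φ k)) (N := fun k => thickening s (E (φ k))) (δ := 2 * s) (by positivity)
    (fun k => isOpen_thickening.measurableSet) (fun k => hEP _) (fun k => hEQ _)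
    (fun k => hg1 _) (fun k => hg _) hsep
    (fun j k hkj x hx => by
      by_contra hne
      obtain ⟨p, hp, hxp⟩ := mem_thickening_iff.1 hx
      linarith [hfar j k hkj x p hne hp])
    (fun j k hjk => (hφr j k hjk).2.2.trans (mul_le_mul_of_nonneg_left
      (pow_le_pow_of_le_one (by norm_num) (by norm_num) (hmono.id_le j)) hη.le)) hη.le
  have hG1 : ∀ x, |∑' j, g (φ j) x| ≤ 1 := fun x => by
    obtain ⟨i, hi⟩ := exists_forall_ne_eq_zero_of_separated (g := fun k => g (φ k)) hsep x x
      (by simpa using hs)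
    rw [tsum_eq_single i fun j hj => (hi j hj).1]
    exact hg1 _ x
  have hGlim := ((h _ (uniformContinuous_tsum_of_separated (g := fun k => g (φ k))
    (δ := 2 * s) (by positivity) (fun k => hg _) hsep) ⟨1, hG1⟩).comp hmono.tendsto_atTop).abs
  rw [abs_zero] at hGlim
  obtain ⟨k, hk⟩ := (hGlim.eventually_lt_const hη).exists
  simp only [Function.comp_apply] at hk
  have hdiff : ∀ (μ : Measure H) [IsProbabilityMeasure μ],
      μ.real (thickening s (E (φ k)))ᶜ ≤ η →
      |(∫ x, u (φ k) x ∂μ) - ∫ x, g (φ k) x ∂μ| ≤ 3 * η := by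
    intro μ _ hμ
    rw [← integral_sub (integrable_of_uniformContinuous_of_abs_le_one μ
      (uniformContinuous_of_abs_sub_le_mul_dist (hu _)) (hu1 _))
      (integrable_of_uniformContinuous_of_abs_le_one μ (hguc _) (hg1 _))]
    have := abs_integral_le_of_abs_le_add_indicator μ isOpen_thickening.measurableSet
      (by positivity) hμ (hg_sub (φ k)) (hg_near (φ k))
    linarith
  have hP := hdiff (P (φ k)) (hEP _)
  have hQ := hdiff (Q (φ k)) (hEQ _)
  have h1 := hφ k
  have h2 := hclose k
  grind

/-- Convergence of differences of integrals of bounded uniformly continuous functions is uniform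
over bounded equi-Lipschitz families. -/
lemma tendsto_integral_sub_of_equiLipschitz [TopologicalSpace.SeparableSpace H]
    {P Q : ℕ → Measure H}
    [∀ n, IsProbabilityMeasure (P n)] [∀ n, IsProbabilityMeasure (Q n)]
    (h : ∀ f : H → ℝ, UniformContinuous f → (∃ C : ℝ, ∀ x, |f x| ≤ C) →
      Tendsto (fun n => (∫ x, f x ∂(P n)) - ∫ x, f x ∂(Q n)) atTop (𝓝 0))
    {f : ℕ → H → ℝ} {L : ℝ} (hL : 0 < L) (hf : ∀ n x y, |f n x - f n y| ≤ L * dist x y)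
    (hf01 : ∀ n x, f n x ∈ Icc (0 : ℝ) 1) :
    Tendsto (fun n => (∫ x, f n x ∂(P n)) - ∫ x, f n x ∂(Q n)) atTop (𝓝 0) := by
  rw [Metric.tendsto_nhds]
  intro ε hε
  by_contra hcon
  rw [not_eventually] at hcon
  obtain ⟨U, hU⟩ := @Ultrafilter.exists_le _ _ (frequently_iff_neBot.1 hcon)
  have hUtop : (U : Filter ℕ) ≤ atTop := hU.trans inf_le_left
  have hUε : ∀ᶠ n in (U : Filter ℕ), ε ≤ |(∫ x, f n x ∂(P n)) - ∫ x, f n x ∂(Q n)| := by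
    filter_upwards [hU.trans inf_le_right (mem_principal_self _)] with n hn
    simpa [Real.dist_eq] using hn
  have hlim : ∀ x, ∃ a ∈ Icc (0 : ℝ) 1, Tendsto (fun n => f n x) U (𝓝 a) := fun x =>
    isCompact_Icc.ultrafilter_le_nhds (U.map fun n => f n x)
      (tendsto_principal.2 (Eventually.of_forall fun n => hf01 n x))
  choose f₀ hf₀01 hf₀ using hlim
  have hf₀L : ∀ x y, |f₀ x - f₀ y| ≤ L * dist x y := fun x y =>
    le_of_tendsto ((hf₀ x).sub (hf₀ y)).abs (Eventually.of_forall fun n => hf n x y)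
  have hf₀1 : ∀ x, |f₀ x| ≤ 1 := fun x => by
    rw [abs_of_nonneg (hf₀01 x).1]
    exact (hf₀01 x).2
  have hf1 : ∀ n x, |f n x| ≤ 1 := fun n x => by
    rw [abs_of_nonneg (hf01 n x).1]
    exact (hf01 n x).2
  have hf₀uc := uniformContinuous_of_abs_sub_le_mul_dist hf₀L
  have hfreq := frequently_abs_integral_sub_lt h hUtop (u := fun n x => f n x - f₀ x)
    (K := 2 * L) (by positivity)
    (fun n x y => by
      have h1 := hf n x y
      have h2 := hf₀L x y
      rw [abs_le] at h1 h2 ⊢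
      constructor <;> linarith)
    (fun n x => by
      obtain ⟨h1, h2⟩ := hf01 n x
      obtain ⟨h3, h4⟩ := hf₀01 x
      rw [abs_le]
      constructor <;> linarith)
    (fun x => by simpa using (hf₀ x).sub_const (f₀ x)) (half_pos hε)
  have hf₀lim := (h f₀ hf₀uc ⟨1, hf₀1⟩).abs
  rw [abs_zero] at hf₀lim
  obtain ⟨n, hn1, hn2, hn3⟩ :=
    (hfreq.and_eventually (hUε.and (hUtop (hf₀lim.eventually_lt_const (half_pos hε))))).exists
  have hi : ∀ (μ : Measure H) [IsProbabilityMeasure μ],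
      ∫ x, (f n x - f₀ x) ∂μ = (∫ x, f n x ∂μ) - ∫ x, f₀ x ∂μ := fun μ _ =>
    integral_sub (integrable_of_uniformContinuous_of_abs_le_one μ
      (uniformContinuous_of_abs_sub_le_mul_dist (hf n)) (hf1 n))
      (integrable_of_uniformContinuous_of_abs_le_one μ hf₀uc hf₀1)
  simp only [hi] at hn1
  grind

/-- If the Lévy–Prokhorov distance exceeds `ε`, this is witnessed by an `ε⁻¹`-Lipschitz function
with values in the unit interval. -/
lemma exists_lipschitz_of_lt_levyProkhorovDist (μ ν : Measure H) [IsProbabilityMeasure μ]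
    [IsProbabilityMeasure ν] {ε : ℝ} (hε : 0 < ε) (hlt : ε < levyProkhorovDist μ ν) :
    ∃ f : H → ℝ, (∀ x y, |f x - f y| ≤ 1 / ε * dist x y) ∧ (∀ x, f x ∈ Icc (0 : ℝ) 1) ∧
      ε ≤ (∫ x, f x ∂μ) - ∫ x, f x ∂ν := by
  obtain ⟨δ, B, hδ, hB, hμν⟩ : ∃ δ B, ε < δ ∧ MeasurableSet B ∧
      ν (thickening δ B) + ENNReal.ofReal δ < μ B := by
    by_contra! hcon
    exact hlt.not_ge (levyProkhorovDist_le_of_forall_le μ ν hε.le hcon)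
  have hBne : B.Nonempty := by
    rw [nonempty_iff_ne_empty]
    rintro rfl
    simp at hμν
  have hreal : ν.real (thickening ε B) + ε ≤ μ.real B := by
    have h1 : ν (thickening ε B) + ENNReal.ofReal ε ≤ μ B :=
      (add_le_add (measure_mono (thickening_mono hδ.le B))
        (ENNReal.ofReal_le_ofReal hδ.le)).trans hμν.le
    have h2 := ENNReal.toReal_mono (measure_ne_top μ B) h1
    rwa [ENNReal.toReal_add (measure_ne_top _ _) ENNReal.ofReal_ne_top,
      ENNReal.toReal_ofReal hε.le] at h2
  set f : H → ℝ := fun x => max 0 (min 1 (1 - infDist x B / ε)) with hf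
  have hf0 : ∀ x, 0 ≤ f x := fun x => le_max_left _ _
  have hf1 : ∀ x, f x ≤ 1 := fun x =>
    max_le zero_le_one (min_le_left _ _)
  have hlip : ∀ x y, |f x - f y| ≤ 1 / ε * dist x y :=
    abs_max_zero_min_sub_infDist_div_le B hε
  have hint : ∀ (κ : Measure H) [IsProbabilityMeasure κ], Integrable f κ := fun κ _ =>
    integrable_of_uniformContinuous_of_abs_le_one κ
      (uniformContinuous_of_abs_sub_le_mul_dist hlip)
      fun x => by simpa [abs_of_nonneg (hf0 x)] using hf1 x
  refine ⟨f, hlip, fun x => ⟨hf0 x, hf1 x⟩, ?_⟩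
  have hlow : μ.real B ≤ ∫ x, f x ∂μ := by
    rw [← integral_indicator_one hB]
    refine integral_mono ((integrable_const 1).indicator hB) (hint μ) fun x => ?_
    by_cases hx : x ∈ B
    · simp [hx, hf, infDist_zero_of_mem hx]
    · simpa [hx] using hf0 x
  have hupp : ∫ x, f x ∂ν ≤ ν.real (thickening ε B) := by
    have hm : MeasurableSet (thickening ε B) := isOpen_thickening.measurableSet
    rw [← integral_indicator_one hm]
    refine integral_mono (hint ν) ((integrable_const 1).indicator hm) fun x => ?_
    by_cases hx : x ∈ thickening ε B
    · simpa [hx] using hf1 x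
    · have h1 : ε ≤ infDist x B := (le_infDist hBne).2 fun y hy => by
        by_contra! hlt'
        exact hx (mem_thickening_iff.2 ⟨_, hy, hlt'⟩)
      have h2 : 1 ≤ infDist x B / ε := (one_le_div hε).2 h1
      have h3 : f x = 0 := max_eq_left ((min_le_right _ _).trans (by linarith))
      simp [hx, h3]
  linarith

end UniformConvergence

/-- If `∫ f dPₙ − ∫ f dQₙ → 0` for every bounded uniformly continuous
`f : H → ℝ`, then the Lévy–Prokhorov distance `π(Pₙ, Qₙ) → 0`. -/
theorem weak_uc_convergence_implies_levyProkhorov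
    {H : Type*} [MetricSpace H] [CompleteSpace H] [TopologicalSpace.SeparableSpace H]
    [MeasurableSpace H] [BorelSpace H]
    (P Q : ℕ → Measure H)
    [∀ n, IsProbabilityMeasure (P n)] [∀ n, IsProbabilityMeasure (Q n)]
    (h : ∀ f : H → ℝ, UniformContinuous f → (∃ C : ℝ, ∀ x, |f x| ≤ C) →
      Tendsto (fun n => (∫ x, f x ∂(P n)) - ∫ x, f x ∂(Q n)) atTop (𝓝 0)) :
    Tendsto (fun n => levyProkhorovDist (P n) (Q n)) atTop (𝓝 0) := by
  have hwit : ∀ ε > 0, ∀ n, ∃ f : H → ℝ, (∀ x y, |f x - f y| ≤ 1 / ε * dist x y) ∧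
      (∀ x, f x ∈ Icc (0 : ℝ) 1) ∧
      (ε < levyProkhorovDist (P n) (Q n) → ε ≤ (∫ x, f x ∂P n) - ∫ x, f x ∂Q n) := by
    intro ε hε n
    by_cases hlt : ε < levyProkhorovDist (P n) (Q n)
    · obtain ⟨f, hf, hf01, hfε⟩ := exists_lipschitz_of_lt_levyProkhorovDist _ _ hε hlt
      exact ⟨f, hf, hf01, fun _ => hfε⟩
    · exact ⟨fun _ => 0, fun x y => by simp only [sub_self, abs_zero]; positivity,
        fun x => by simp, fun hlt' => absurd hlt' hlt⟩
  rw [Metric.tendsto_nhds]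
  intro ε hε
  choose f hf hf01 hfε using hwit (ε / 2) (half_pos hε)
  have hlim := tendsto_integral_sub_of_equiLipschitz h (by positivity) hf hf01
  filter_upwards [hlim.eventually_lt_const (half_pos hε)] with n hn
  have hle : levyProkhorovDist (P n) (Q n) ≤ ε / 2 := not_lt.1 fun hlt => (hfε n hlt).not_gt hn
  rw [Real.dist_0_eq_abs, abs_of_nonneg (show 0 ≤ levyProkhorovDist (P n) (Q n) from
    ENNReal.toReal_nonneg)]
  linarith
end

section
/- Let (H, ρ) be a complete separable metric space and let {P_n}, {Q_n} be sequences of Borel probability measures on H with π(P_n, Q_n) → 0, where π denotes the Lévy–Prokhorov metric. Then there exist a probability space (Ω, 𝒜, P) and random elements X_n, Y_n : Ω → H such that the law of X_n is P_n, the law of Y_n is Q_n, and ρ(X_n, Y_n) → 0 in probability. -/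
open MeasureTheory Filter Topology Metric Set

open scoped ENNReal NNReal

open Classical in
/-- Hall's marriage theorem with multiplicities and deficiency `D`. -/
lemma exists_nat_transport {ι κ : Type*} [Fintype ι] [Fintype κ] (a : ι → ℕ) (b : κ → ℕ)
    (r : ι → κ → Prop) (D : ℕ)
    (h : ∀ I : Finset ι, ∑ i ∈ I, a i ≤ ∑ j with ∃ i ∈ I, r i j, b j + D) :
    ∃ w : ι → κ → ℕ, (∀ i j, w i j ≠ 0 → r i j) ∧ (∀ i, ∑ j, w i j ≤ a i) ∧
      (∀ j, ∑ i, w i j ≤ b j) ∧ ∑ i, a i ≤ ∑ i, ∑ j, w i j + D := by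
  let R : (Σ i, Fin (a i)) → (Σ j, Fin (b j)) ⊕ Fin D → Prop :=
    fun x y => ∀ z, y = Sum.inl z → r x.1 z.1
  have hall : ∀ A : Finset (Σ i, Fin (a i)), A.card ≤
      (Finset.univ.filter fun y => ∃ x ∈ A, R x y).card := by
    intro A
    rcases A.eq_empty_or_nonempty with rfl | ⟨x₀, hx₀⟩
    · simp
    let I := A.image Sigma.fst
    let J : Finset κ := Finset.univ.filter fun j => ∃ i ∈ I, r i j
    calc A.card ≤ (I.sigma fun i => (Finset.univ : Finset (Fin (a i)))).card := by
          refine Finset.card_le_card fun x hx => ?_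
          simp only [Finset.mem_sigma, Finset.mem_univ, and_true]
          exact Finset.mem_image_of_mem _ hx
      _ = ∑ i ∈ I, a i := by simp [Finset.card_sigma]
      _ ≤ ∑ j ∈ J, b j + D := h I
      _ = ((J.sigma fun j => (Finset.univ : Finset (Fin (b j)))).disjSum
            (Finset.univ : Finset (Fin D))).card := by
          simp [Finset.card_disjSum, Finset.card_sigma]
      _ ≤ _ := by
          refine Finset.card_le_card fun y hy => ?_
          simp only [Finset.mem_filter, Finset.mem_univ, true_and]
          rcases y with y | y
          · simp only [Finset.inl_mem_disjSum, Finset.mem_sigma, Finset.mem_univ, and_true, J,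
              Finset.mem_filter, true_and, I, Finset.mem_image] at hy
            obtain ⟨_, ⟨x, hx, rfl⟩, hr⟩ := hy
            exact ⟨x, hx, fun z hz => by cases hz; exact hr⟩
          · exact ⟨x₀, hx₀, fun z hz => by cases hz⟩
  obtain ⟨f, hf, hfR⟩ := (Fintype.all_card_le_filter_rel_iff_exists_injective R).1 hall
  let g : (Σ i, Fin (a i)) → Option κ := fun x => (f x).elim (fun y => some y.1) fun _ => none
  have hg : ∀ {x j}, g x = some j → ∃ y : Fin (b j), f x = Sum.inl ⟨j, y⟩ := by
    intro x j hx
    rcases hfx : f x with y | y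
    · simp only [g, hfx, Sum.elim_inl, Option.some.injEq] at hx
      subst hx
      exact ⟨y.2, rfl⟩
    · simp [g, hfx] at hx
  have hg' : ∀ {x}, g x = none → ∃ y : Fin D, f x = Sum.inr y := by
    intro x hx
    rcases hfx : f x with y | y
    · simp [g, hfx] at hx
    · exact ⟨y, rfl⟩
  have hsum : ∀ i, ∑ j, (Finset.univ.filter fun x : Σ i, Fin (a i) => x.1 = i ∧ g x = some j).card
      + (Finset.univ.filter fun x : Σ i, Fin (a i) => x.1 = i ∧ g x = none).card = a i := by
    intro i
    have h1 : (Finset.univ.filter fun x : Σ i, Fin (a i) => x.1 = i).card = a i := by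
      have : (Finset.univ.filter fun x : Σ i, Fin (a i) => x.1 = i) =
          ({i} : Finset ι).sigma fun i => (Finset.univ : Finset (Fin (a i))) := by
        ext x; simp
      rw [this]; simp
    rw [Finset.card_eq_sum_card_fiberwise (f := g) (t := Finset.univ) (by simp),
      Fintype.sum_option] at h1
    simp only [Finset.filter_filter] at h1
    omega
  refine ⟨fun i j => (Finset.univ.filter fun x : Σ i, Fin (a i) => x.1 = i ∧ g x = some j).card,
    fun i j hw => ?_, fun i => ?_, fun j => ?_, ?_⟩
  · obtain ⟨x, hx⟩ := Finset.card_ne_zero.1 hw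
    simp only [Finset.mem_filter, Finset.mem_univ, true_and] at hx
    obtain ⟨y, hy⟩ := hg hx.2
    exact hx.1 ▸ hfR x _ hy
  · exact (Nat.le_add_right _ _).trans (hsum i).le
  · have h1 := Finset.card_eq_sum_card_fiberwise (f := Sigma.fst)
      (s := Finset.univ.filter fun x => g x = some j) (t := Finset.univ) (by simp)
    simp only [Finset.filter_filter] at h1
    simp only [and_comm (b := g _ = some j)]
    rw [← h1]
    calc _ ≤ ((Finset.univ : Finset (Fin (b j))).image fun y =>
          (Sum.inl ⟨j, y⟩ : (Σ j, Fin (b j)) ⊕ Fin D)).card := by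
          refine Finset.card_le_card_of_injOn f (fun x hx => ?_) hf.injOn
          simp only [Finset.coe_filter, Finset.mem_univ, true_and, Set.mem_ofPred_eq] at hx
          obtain ⟨y, hy⟩ := hg hx
          simp [hy]
      _ ≤ b j := Finset.card_image_le.trans (by simp)
  · have h1 : ∑ i, (Finset.univ.filter fun x : Σ i, Fin (a i) => x.1 = i ∧ g x = none).card
        ≤ D := by
      have h2 := Finset.card_eq_sum_card_fiberwise (f := Sigma.fst)
        (s := Finset.univ.filter fun x => g x = none) (t := Finset.univ) (by simp)
      simp only [Finset.filter_filter] at h2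
      simp only [and_comm (b := g _ = none)]
      rw [← h2]
      calc _ ≤ ((Finset.univ : Finset (Fin D)).image fun y =>
          (Sum.inr y : (Σ j, Fin (b j)) ⊕ Fin D)).card := by
            refine Finset.card_le_card_of_injOn f (fun x hx => ?_) hf.injOn
            simp only [Finset.coe_filter, Finset.mem_univ, true_and, Set.mem_ofPred_eq] at hx
            obtain ⟨y, hy⟩ := hg' hx
            simp [hy]
        _ ≤ D := Finset.card_image_le.trans (by simp)
    calc ∑ i, a i = _ := (Finset.sum_congr rfl fun i _ => hsum i).symm
      _ ≤ _ := by
        rw [Finset.sum_add_distrib]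
        gcongr

open Classical in
/-- Approximate max-flow min-cut for finite transport problems. -/
lemma exists_transport {ι κ : Type*} [Fintype ι] [Fintype κ] (p : ι → ℝ≥0) (q : κ → ℝ≥0)
    (r : ι → κ → Prop) (c δ : ℝ≥0) (hδ : 0 < δ)
    (h : ∀ I : Finset ι, ∑ i ∈ I, p i ≤ ∑ j with ∃ i ∈ I, r i j, q j + c) :
    ∃ w : ι → κ → ℝ≥0, (∀ i j, w i j ≠ 0 → r i j) ∧ (∀ i, ∑ j, w i j ≤ p i) ∧
      (∀ j, ∑ i, w i j ≤ q j) ∧ ∑ i, p i ≤ ∑ i, ∑ j, w i j + c + δ := by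
  obtain ⟨N, hN⟩ := exists_nat_gt ((Fintype.card ι + Fintype.card κ + 1) / δ)
  have hN0 : (0 : ℝ≥0) < N := lt_of_le_of_lt zero_le hN
  rw [div_lt_iff₀ hδ] at hN
  obtain ⟨w, hr, hrow, hcol, htot⟩ := exists_nat_transport (fun i => ⌊N * p i⌋₊)
    (fun j => ⌊N * q j⌋₊) r (⌈N * c⌉₊ + Fintype.card κ) (by
      intro I
      have : (∑ i ∈ I, (⌊N * p i⌋₊ : ℝ≥0)) ≤ ∑ j with ∃ i ∈ I, r i j, (⌊N * q j⌋₊ : ℝ≥0) +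
          (⌈N * c⌉₊ + Fintype.card κ) := by
        calc (∑ i ∈ I, (⌊N * p i⌋₊ : ℝ≥0)) ≤ ∑ i ∈ I, N * p i := by
              gcongr; exact Nat.floor_le zero_le
          _ ≤ N * (∑ j with ∃ i ∈ I, r i j, q j + c) := by
              rw [← Finset.mul_sum]; gcongr; exact h I
          _ = ∑ j with ∃ i ∈ I, r i j, N * q j + N * c := by rw [mul_add, Finset.mul_sum]
          _ ≤ ∑ j with ∃ i ∈ I, r i j, ((⌊N * q j⌋₊ : ℝ≥0) + 1) + ⌈N * c⌉₊ := by
              gcongr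
              · exact (Nat.lt_floor_add_one _).le
              · exact Nat.le_ceil _
          _ ≤ _ := by
              rw [Finset.sum_add_distrib, add_assoc, add_comm (⌈N * c⌉₊ : ℝ≥0)]
              gcongr
              simpa using Finset.card_le_univ _
      exact_mod_cast this)
  refine ⟨fun i j => w i j / N, fun i j hw => hr i j fun h0 => hw (by simp [h0]), fun i => ?_,
    fun j => ?_, ?_⟩
  · rw [← Finset.sum_div, div_le_iff₀ hN0, mul_comm]
    calc (∑ j, (w i j : ℝ≥0)) ≤ ⌊N * p i⌋₊ := mod_cast hrow i
      _ ≤ _ := Nat.floor_le zero_le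
  · rw [← Finset.sum_div, div_le_iff₀ hN0, mul_comm]
    calc (∑ i, (w i j : ℝ≥0)) ≤ ⌊N * q j⌋₊ := mod_cast hcol j
      _ ≤ _ := Nat.floor_le zero_le
  · simp only [← Finset.sum_div]
    rw [← mul_le_mul_iff_right₀ hN0, mul_add, mul_add, mul_div_cancel₀ _ hN0.ne']
    calc N * ∑ i, p i = ∑ i, N * p i := Finset.mul_sum ..
      _ ≤ ∑ i, ((⌊N * p i⌋₊ : ℝ≥0) + 1) := by
          gcongr; exact (Nat.lt_floor_add_one _).le
      _ = ∑ i, (⌊N * p i⌋₊ : ℝ≥0) + Fintype.card ι := by simp [Finset.sum_add_distrib]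
      _ ≤ (∑ i, ∑ j, (w i j : ℝ≥0) + (⌈N * c⌉₊ + Fintype.card κ)) + Fintype.card ι := by
          gcongr; exact_mod_cast htot
      _ ≤ (∑ i, ∑ j, (w i j : ℝ≥0) + ((N * c + 1) + Fintype.card κ)) + Fintype.card ι := by
          gcongr; exact (Nat.ceil_lt_add_one zero_le).le
      _ = ∑ i, ∑ j, (w i j : ℝ≥0) + N * c + (Fintype.card ι + Fintype.card κ + 1) := by ring
      _ ≤ _ := by gcongr

lemma inv_smul_smul_of_measure_univ_eq {α : Type*} [MeasurableSpace α] {R : Measure α} {c : ℝ≥0∞}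
    (hR : R univ = c) (hc : c ≠ ∞) : c⁻¹ • c • R = R := by
  by_cases h0 : c = 0
  · rw [h0, Measure.measure_univ_eq_zero] at hR
    simp [hR]
  · rw [smul_smul, ENNReal.inv_mul_cancel h0 hc, one_smul]

/-- A sub-coupling of two probability measures extends to a coupling. -/
lemma exists_coupling_ge {α β : Type*} [MeasurableSpace α] [MeasurableSpace β]
    (P : Measure α) (Q : Measure β) [IsProbabilityMeasure P] [IsProbabilityMeasure Q]
    (γ₀ : Measure (α × β)) (h₁ : γ₀.map Prod.fst ≤ P) (h₂ : γ₀.map Prod.snd ≤ Q) :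
    ∃ γ : Measure (α × β), γ₀ ≤ γ ∧ γ.map Prod.fst = P ∧ γ.map Prod.snd = Q := by
  have e₁ : γ₀.map Prod.fst univ = γ₀ univ := by
    rw [Measure.map_apply measurable_fst .univ, preimage_univ]
  have e₂ : γ₀.map Prod.snd univ = γ₀ univ := by
    rw [Measure.map_apply measurable_snd .univ, preimage_univ]
  have : IsFiniteMeasure γ₀ := ⟨by
    rw [← e₁]; exact (h₁ univ).trans_lt (measure_lt_top _ _)⟩
  set P' := P - γ₀.map Prod.fst
  set Q' := Q - γ₀.map Prod.snd
  have hP' : P' univ = 1 - γ₀ univ := by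
    rw [Measure.sub_apply .univ h₁, e₁, measure_univ]
  have hQ' : Q' univ = 1 - γ₀ univ := by
    rw [Measure.sub_apply .univ h₂, e₂, measure_univ]
  have : IsFiniteMeasure P' := ⟨by rw [hP']; finiteness⟩
  have : IsFiniteMeasure Q' := ⟨by rw [hQ']; finiteness⟩
  refine ⟨γ₀ + (1 - γ₀ univ)⁻¹ • P'.prod Q', Measure.le_add_right le_rfl, ?_, ?_⟩
  · rw [Measure.map_add _ _ measurable_fst, Measure.map_smul, Measure.map_fst_prod, hQ',
      inv_smul_smul_of_measure_univ_eq hP' (by finiteness), add_comm]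
    exact Measure.sub_add_cancel_of_le h₁
  · rw [Measure.map_add _ _ measurable_snd, Measure.map_smul, Measure.map_snd_prod, hP',
      inv_smul_smul_of_measure_univ_eq hQ' (by finiteness), add_comm]
    exact Measure.sub_add_cancel_of_le h₂

lemma measure_smul_cond_le {α : Type*} [MeasurableSpace α] (P : Measure α) [IsFiniteMeasure P]
    (A : Set α) {c : ℝ≥0∞} (hc : c ≤ P A) : c • ProbabilityTheory.cond P A ≤ P.restrict A := by
  refine Measure.le_iff.2 fun s _ => ?_
  rw [ProbabilityTheory.cond, Measure.smul_apply, Measure.smul_apply, smul_eq_mul, smul_eq_mul,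
    ← mul_assoc]
  refine mul_le_of_le_one_left zero_le ?_
  rw [← div_eq_mul_inv]
  exact ENNReal.div_le_of_le_mul (by simpa using hc)

lemma sum_restrict_preimage_le {α ι κ : Type*} [MeasurableSpace α] [Fintype ι]
    [MeasurableSpace κ] [MeasurableSingletonClass κ] (P : Measure α) {φ : α → κ}
    (hφ : Measurable φ) {e : ι → κ} (he : e.Injective) :
    ∑ i, P.restrict (φ ⁻¹' {e i}) ≤ P := by
  rw [← Measure.sum_fintype, ← Measure.restrict_iUnion]
  · exact Measure.restrict_le_self
  · intro i j hij
    exact Disjoint.preimage _ (by simpa using he.ne hij)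
  · exact fun i => hφ (measurableSet_singleton _)

/-- A finite family of weights on pairs of cells of a partition, bounded by the masses of the
cells, gives a coupling charging each rectangle of cells at least its weight. -/
lemma exists_coupling_of_weights {α : Type*} [MeasurableSpace α] (P Q : Measure α)
    [IsProbabilityMeasure P] [IsProbabilityMeasure Q] {φ : α → ℕ} (hφ : Measurable φ) {k : ℕ}
    (w : Fin k → Fin k → ℝ≥0) (hrow : ∀ i, ∑ j, (w i j : ℝ≥0∞) ≤ P (φ ⁻¹' {(i : ℕ)}))
    (hcol : ∀ j, ∑ i, (w i j : ℝ≥0∞) ≤ Q (φ ⁻¹' {(j : ℕ)})) (S : Set (α × α))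
    (hS : ∀ i j, w i j ≠ 0 → (φ ⁻¹' {(i : ℕ)}) ×ˢ (φ ⁻¹' {(j : ℕ)}) ⊆ S) :
    ∃ γ : Measure (α × α), γ.map Prod.fst = P ∧ γ.map Prod.snd = Q ∧
      ∑ i, ∑ j, (w i j : ℝ≥0∞) ≤ γ S := by
  let A : Fin k → Set α := fun i => φ ⁻¹' {(i : ℕ)}
  let p : Fin k → Measure α := fun i => ProbabilityTheory.cond P (A i)
  let q : Fin k → Measure α := fun i => ProbabilityTheory.cond Q (A i)
  let γ₀ : Measure (α × α) := ∑ i, ∑ j, (w i j : ℝ≥0∞) • (p i).prod (q j)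
  have hle : ∀ (R : Measure α) [IsProbabilityMeasure R] (B : Set α),
      ProbabilityTheory.cond R B univ ≤ 1 := by
    intro R _ B
    rw [ProbabilityTheory.cond_apply' .univ, inter_univ]
    exact ENNReal.inv_mul_le_one _
  have map_sum : ∀ f : α × α → α, Measurable f → γ₀.map f =
      ∑ i, ∑ j, (w i j : ℝ≥0∞) • ((p i).prod (q j)).map f := by
    intro f hf
    simp only [γ₀, ← Measure.mapₗ_apply_of_measurable hf, map_sum, map_smul]
  have h₁ : γ₀.map Prod.fst ≤ P := by
    rw [map_sum _ measurable_fst]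
    refine le_trans ?_ (sum_restrict_preimage_le P hφ (e := fun i : Fin k => (i : ℕ))
      Fin.val_injective)
    refine Finset.sum_le_sum fun i _ => le_trans ?_ (measure_smul_cond_le P (A i) (hrow i))
    rw [Finset.sum_smul]
    refine Finset.sum_le_sum fun j _ => Measure.le_iff.2 fun s _ => ?_
    simp only [Measure.map_fst_prod, Measure.smul_apply, smul_eq_mul]
    gcongr
    exact mul_le_of_le_one_left zero_le (hle Q _)
  have h₂ : γ₀.map Prod.snd ≤ Q := by
    rw [map_sum _ measurable_snd, Finset.sum_comm]
    refine le_trans ?_ (sum_restrict_preimage_le Q hφ (e := fun i : Fin k => (i : ℕ))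
      Fin.val_injective)
    refine Finset.sum_le_sum fun j _ => le_trans ?_ (measure_smul_cond_le Q (A j) (hcol j))
    rw [Finset.sum_smul]
    refine Finset.sum_le_sum fun i _ => Measure.le_iff.2 fun s _ => ?_
    simp only [Measure.map_snd_prod, Measure.smul_apply, smul_eq_mul]
    gcongr
    exact mul_le_of_le_one_left zero_le (hle P _)
  obtain ⟨γ, hγ, hfst, hsnd⟩ := exists_coupling_ge P Q γ₀ h₁ h₂
  refine ⟨γ, hfst, hsnd, le_trans ?_ (hγ S)⟩
  simp only [γ₀, Measure.finsetSum_apply, Measure.smul_apply, smul_eq_mul]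
  refine Finset.sum_le_sum fun i _ => Finset.sum_le_sum fun j _ => ?_
  by_cases hw : w i j = 0
  · simp [hw]
  have hw' : (w i j : ℝ≥0∞) ≠ 0 := by simpa using hw
  have hP : P (A i) ≠ 0 := fun h0 => hw' <| le_zero_iff.1 <|
    (Finset.single_le_sum (f := fun j => (w i j : ℝ≥0∞)) (fun _ _ => zero_le)
      (Finset.mem_univ j)).trans ((hrow i).trans h0.le)
  have hQ : Q (A j) ≠ 0 := fun h0 => hw' <| le_zero_iff.1 <|
    (Finset.single_le_sum (f := fun i => (w i j : ℝ≥0∞)) (fun _ _ => zero_le)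
      (Finset.mem_univ i)).trans ((hcol j).trans h0.le)
  calc (w i j : ℝ≥0∞) = w i j * ((p i).prod (q j)) (A i ×ˢ A j) := by
        simp only [p, q]
        rw [Measure.prod_prod, ProbabilityTheory.cond_apply_self hP (measure_ne_top _ _),
          ProbabilityTheory.cond_apply_self hQ (measure_ne_top _ _), mul_one, mul_one]
    _ ≤ _ := by gcongr; exact hS i j hw

lemma exists_measure_preimage_Ici_le {α : Type*} [MeasurableSpace α] (P : Measure α)
    [IsFiniteMeasure P] {φ : α → ℕ} (hφ : Measurable φ) {ε : ℝ≥0∞} (hε : 0 < ε) :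
    ∀ᶠ k in atTop, P (φ ⁻¹' Ici k) ≤ ε := by
  have h := tendsto_measure_iInter_atTop (μ := P) (s := fun k => φ ⁻¹' Ici k)
    (fun k => (hφ measurableSet_Ici).nullMeasurableSet)
    (fun a b hab => preimage_mono (Ici_subset_Ici.2 hab)) ⟨0, measure_ne_top _ _⟩
  have h0 : ⋂ k, φ ⁻¹' Ici k = ∅ := by
    refine eq_empty_of_forall_notMem fun x hx => ?_
    have := mem_iInter.1 hx (φ x + 1)
    simp at this
  rw [h0, measure_empty] at h
  exact h.eventually (Iic_mem_nhds hε)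

lemma exists_measurable_nat_dist_le {H : Type*} [PseudoMetricSpace H]
    [TopologicalSpace.SeparableSpace H] [MeasurableSpace H] [OpensMeasurableSpace H] {ε : ℝ}
    (hε : 0 < ε) : ∃ φ : H → ℕ, Measurable φ ∧ ∀ x y, φ x = φ y → dist x y ≤ ε := by
  classical
  rcases isEmpty_or_nonempty H with _ | _
  · exact ⟨fun _ => 0, measurable_const, fun x => isEmptyElim x⟩
  let u := TopologicalSpace.denseSeq H
  have hu : ∀ x, ∃ n, dist x (u n) < ε / 2 := fun x =>
    (TopologicalSpace.denseRange_denseSeq H).exists_dist_lt x (half_pos hε)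
  refine ⟨fun x => Nat.find (hu x), measurable_find hu fun k => measurableSet_ball, ?_⟩
  intro x y hxy
  have h1 := Nat.find_spec (hu x)
  have h2 := Nat.find_spec (hu y)
  simp only at hxy
  rw [← hxy] at h2
  have := dist_triangle_right x y (u (Nat.find (hu x)))
  linarith

lemma sum_measure_preimage_fin {α : Type*} [MeasurableSpace α] (P : Measure α) {φ : α → ℕ}
    (hφ : Measurable φ) {k : ℕ} (I : Finset (Fin k)) :
    ∑ i ∈ I, P (φ ⁻¹' {(i : ℕ)}) = P (⋃ i ∈ I, φ ⁻¹' {(i : ℕ)}) := by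
  rw [measure_biUnion_finset]
  · intro i _ j _ hij
    exact Disjoint.preimage _ (by simpa using Fin.val_injective.ne hij)
  · exact fun i _ => hφ (measurableSet_singleton _)

/-- Quantitative form of Strassen's theorem, with non-optimal constants. -/
lemma exists_coupling_of_levyProkhorovEDist_lt {H : Type*} [PseudoMetricSpace H]
    [TopologicalSpace.SeparableSpace H] [MeasurableSpace H] [OpensMeasurableSpace H]
    (P Q : Measure H) [IsProbabilityMeasure P] [IsProbabilityMeasure Q] {ε : ℝ≥0} (hε : 0 < ε)
    (h : levyProkhorovEDist P Q < ε) :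
    ∃ γ : Measure (H × H), γ.map Prod.fst = P ∧ γ.map Prod.snd = Q ∧
      γ {z | 3 * (ε : ℝ) < dist z.1 z.2} ≤ 4 * ε := by
  classical
  obtain ⟨φ, hφ, hφε⟩ := exists_measurable_nat_dist_le (H := H) (NNReal.coe_pos.2 hε)
  have hε' : (0 : ℝ≥0∞) < ε := by simpa using hε
  obtain ⟨k, hkP, hkQ⟩ := ((exists_measure_preimage_Ici_le P hφ hε').and
    (exists_measure_preimage_Ici_le Q hφ hε')).exists
  let A : Fin k → Set H := fun i => φ ⁻¹' {(i : ℕ)}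
  let r : Fin k → Fin k → Prop := fun i j => ∃ x ∈ A i, ∃ y ∈ A j, dist x y < ε
  have hall : ∀ I : Finset (Fin k), ∑ i ∈ I, (P (A i)).toNNReal ≤
      ∑ j with ∃ i ∈ I, r i j, (Q (A j)).toNNReal + 2 * ε := by
    intro I
    rw [← ENNReal.coe_le_coe]
    push_cast
    simp only [ENNReal.coe_toNNReal (measure_ne_top _ _)]
    set J : Finset (Fin k) := Finset.univ.filter fun j => ∃ i ∈ I, r i j
    have hsub : thickening (ε : ℝ) (⋃ i ∈ I, A i) ⊆ (⋃ j ∈ J, A j) ∪ φ ⁻¹' Ici k := by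
      intro y hy
      obtain ⟨x, hx, hxy⟩ := mem_thickening_iff.1 hy
      simp only [mem_iUnion, exists_prop] at hx
      obtain ⟨i, hi, hx⟩ := hx
      by_cases hyk : k ≤ φ y
      · exact Or.inr hyk
      · left
        simp only [mem_iUnion, exists_prop]
        refine ⟨⟨φ y, not_le.1 hyk⟩, ?_, rfl⟩
        simp only [J, Finset.mem_filter, Finset.mem_univ, true_and]
        exact ⟨i, hi, x, hx, y, rfl, by rwa [dist_comm]⟩
    calc ∑ i ∈ I, P (A i) = P (⋃ i ∈ I, A i) := sum_measure_preimage_fin P hφ I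
      _ ≤ Q (thickening (ε : ℝ) (⋃ i ∈ I, A i)) + ε :=
        left_measure_le_of_levyProkhorovEDist_lt h
          (.biUnion I.countable_toSet fun i _ => hφ (measurableSet_singleton _))
      _ ≤ (Q (⋃ j ∈ J, A j) + Q (φ ⁻¹' Ici k)) + ε := by
        gcongr; exact (measure_mono hsub).trans (measure_union_le _ _)
      _ ≤ (Q (⋃ j ∈ J, A j) + ε) + ε := by gcongr
      _ = _ := by rw [← sum_measure_preimage_fin Q hφ J]; ring
  obtain ⟨w, hr, hrow, hcol, htot⟩ := exists_transport (fun i => (P (A i)).toNNReal)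
    (fun j => (Q (A j)).toNNReal) r (2 * ε) ε hε (fun I => by convert hall I)
  simp only [← ENNReal.coe_le_coe, ENNReal.ofNNReal_finsetSum, ENNReal.coe_add, ENNReal.coe_mul,
    ENNReal.coe_toNNReal (measure_ne_top _ _)] at hrow hcol htot
  let S : Set (H × H) := {z | dist z.1 z.2 ≤ 3 * (ε : ℝ)}
  obtain ⟨γ, hfst, hsnd, hγ⟩ := exists_coupling_of_weights P Q hφ w hrow hcol S (by
    rintro i j hw ⟨x, y⟩ ⟨hx, hy⟩
    obtain ⟨x', hx', y', hy', hd⟩ := hr i j hw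
    have h1 := hφε x x' (Eq.trans hx (Eq.symm hx'))
    have h2 := hφε y' y (Eq.trans hy' (Eq.symm hy))
    have h3 := dist_triangle4 x x' y' y
    change dist x y ≤ 3 * (ε : ℝ)
    linarith)
  refine ⟨γ, hfst, hsnd, ?_⟩
  have hγ1 : γ univ = 1 := by
    rw [← preimage_univ (f := (Prod.fst : H × H → H)), ← Measure.map_apply measurable_fst .univ,
      hfst, measure_univ]
  have hS : MeasurableSet S :=
    (isClosed_le (by fun_prop) (by fun_prop)).measurableSet
  have hcompl : {z : H × H | 3 * (ε : ℝ) < dist z.1 z.2} = Sᶜ := by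
    ext z; simp [S]
  have hP1 : 1 ≤ ∑ i, P (A i) + ε := by
    rw [sum_measure_preimage_fin P hφ Finset.univ, ← measure_univ (μ := P)]
    calc P univ ≤ P ((⋃ i ∈ (Finset.univ : Finset (Fin k)), A i) ∪ φ ⁻¹' Ici k) := by
          refine measure_mono fun x _ => ?_
          by_cases hx : k ≤ φ x
          · exact Or.inr hx
          · left
            simp only [mem_iUnion, exists_prop]
            exact ⟨⟨φ x, not_le.1 hx⟩, Finset.mem_univ _, rfl⟩
      _ ≤ _ := (measure_union_le _ _).trans (by gcongr)
  have hfin : γ S ≠ ∞ := ne_top_of_le_ne_top (by rw [hγ1]; simp) (measure_mono (subset_univ S))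
  rw [hcompl, ← ENNReal.add_le_add_iff_left hfin, measure_add_measure_compl hS, hγ1]
  calc 1 ≤ ∑ i, P (A i) + ε := hP1
    _ ≤ (∑ i, ∑ j, (w i j : ℝ≥0∞) + 2 * ε + ε) + ε := by gcongr; exact htot
    _ = ∑ i, ∑ j, (w i j : ℝ≥0∞) + 4 * ε := by ring
    _ ≤ _ := by gcongr

/-- Countably many measures on a standard Borel space are the laws of random elements defined on
one probability space living in the lowest universe. -/
lemma exists_common_probability_space {E : Type*} [MeasurableSpace E] [StandardBorelSpace E]
    (γ : ℕ → Measure E) [∀ n, IsProbabilityMeasure (γ n)] :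
    ∃ (Ω : Type) (_ : MeasurableSpace Ω) (μ : Measure Ω) (Z : ℕ → Ω → E),
      IsProbabilityMeasure μ ∧ (∀ n, Measurable (Z n)) ∧ ∀ n, μ.map (Z n) = γ n := by
  have : Nonempty E := (γ 0).nonempty_of_neZero
  obtain ⟨f, hf⟩ := exists_measurableEmbedding_real E
  have (n : ℕ) : IsProbabilityMeasure ((γ n).map f) :=
    Measure.isProbabilityMeasure_map hf.measurable.aemeasurable
  refine ⟨ℕ → ℝ, inferInstance, Measure.infinitePi fun n => (γ n).map f,
    fun n ω => hf.invFun (ω n), inferInstance,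
    fun n => hf.measurable_invFun.comp (measurable_pi_apply n), fun n => ?_⟩
  change Measure.map (hf.invFun ∘ fun ω : ℕ → ℝ => ω n) _ = _
  rw [← Measure.map_map hf.measurable_invFun (measurable_pi_apply n),
    Measure.infinitePi_map_eval, Measure.map_map hf.measurable_invFun hf.measurable,
    hf.leftInverse_invFun.comp_eq_id, Measure.map_id]

/-- If the Lévy–Prokhorov distance `π(Pₙ, Qₙ) → 0`, then there exist a
probability space and random elements `Xₙ, Yₙ` with laws `Pₙ, Qₙ` such that
`ρ(Xₙ, Yₙ) → 0` in probability. -/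
theorem exists_coupling_of_levyProkhorov_tendsto_zero
    {H : Type*} [MetricSpace H] [CompleteSpace H] [TopologicalSpace.SeparableSpace H]
    [MeasurableSpace H] [BorelSpace H]
    (P Q : ℕ → Measure H)
    [∀ n, IsProbabilityMeasure (P n)] [∀ n, IsProbabilityMeasure (Q n)]
    (h : Tendsto (fun n => levyProkhorovDist (P n) (Q n)) atTop (𝓝 0)) :
    ∃ (Ω : Type) (_ : MeasurableSpace Ω) (μ : Measure Ω) (X Y : ℕ → Ω → H),
      IsProbabilityMeasure μ ∧
      (∀ n, Measurable (X n)) ∧ (∀ n, Measurable (Y n)) ∧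
      (∀ n, μ.map (X n) = P n) ∧ (∀ n, μ.map (Y n) = Q n) ∧
      (∀ ε : ℝ, 0 < ε →
        Tendsto (fun n => μ {ω | ε < dist (X n ω) (Y n ω)}) atTop (𝓝 0)) := by
  let ε : ℕ → NNReal := fun n => (levyProkhorovDist (P n) (Q n)).toNNReal + ((n : NNReal) + 1)⁻¹
  have hε : ∀ n, 0 < ε n := fun n => by positivity
  have hεlim : Tendsto ε atTop (𝓝 0) := by
    have h1 := (continuous_real_toNNReal.tendsto 0).comp h
    have h2 : Tendsto (fun n : ℕ => ((n : NNReal) + 1)⁻¹) atTop (𝓝 0) := by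
      simpa using tendsto_one_div_add_atTop_nhds_zero_nat (𝕜 := NNReal)
    simpa using h1.add h2
  have hlt : ∀ n, levyProkhorovEDist (P n) (Q n) < ε n := by
    intro n
    rw [← ENNReal.ofReal_toReal (levyProkhorovEDist_ne_top (P n) (Q n))]
    exact ENNReal.coe_lt_coe.2 (lt_add_of_pos_right _ (by positivity))
  choose γ hfst hsnd hγ using fun n =>
    exists_coupling_of_levyProkhorovEDist_lt (P n) (Q n) (hε n) (hlt n)
  have hγprob (n : ℕ) : IsProbabilityMeasure (γ n) := ⟨by
    rw [← preimage_univ (f := (Prod.fst : H × H → H)), ← Measure.map_apply measurable_fst .univ,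
      hfst, measure_univ]⟩
  have : SecondCountableTopology H := UniformSpace.secondCountable_of_separable H
  obtain ⟨Ω, mΩ, μ, Z, hμ, hZ, hmap⟩ := exists_common_probability_space γ
  refine ⟨Ω, mΩ, μ, fun n ω => (Z n ω).1, fun n ω => (Z n ω).2, hμ, fun n => (hZ n).fst,
    fun n => (hZ n).snd, fun n => ?_, fun n => ?_, fun δ hδ => ?_⟩
  · rw [← hfst n, ← hmap n, Measure.map_map measurable_fst (hZ n)]
    rfl
  · rw [← hsnd n, ← hmap n, Measure.map_map measurable_snd (hZ n)]
    rfl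
  · have hlim : Tendsto (fun n => 4 * (ε n : ENNReal)) atTop (𝓝 0) := by
      simpa using ENNReal.Tendsto.const_mul (a := 4) (ENNReal.tendsto_coe.2 hεlim) (by simp)
    have hsmall : ∀ᶠ n in atTop, 3 * (ε n : ℝ) < δ := by
      have h3 : Tendsto (fun n => 3 * (ε n : ℝ)) atTop (𝓝 0) := by
        simpa using (NNReal.tendsto_coe.2 hεlim).const_mul 3
      exact h3.eventually (gt_mem_nhds hδ)
    refine tendsto_of_tendsto_of_tendsto_of_le_of_le' tendsto_const_nhds hlim
      (Eventually.of_forall fun _ => zero_le) ?_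
    filter_upwards [hsmall] with n hn
    have hms : MeasurableSet {z : H × H | δ < dist z.1 z.2} :=
      (isOpen_lt (by fun_prop) (by fun_prop)).measurableSet
    calc μ {ω | δ < dist (Z n ω).1 (Z n ω).2} = γ n {z | δ < dist z.1 z.2} := by
          rw [← hmap n, Measure.map_apply (hZ n) hms]
          rfl
      _ ≤ γ n {z | 3 * (ε n : ℝ) < dist z.1 z.2} :=
        measure_mono fun z hz => hn.trans hz
      _ ≤ _ := hγ n
end

section
/- Let (H, ρ) be a complete separable metric space and let {P_n}, {Q_n} be sequences of Borel probability measures on H. If ∫ f d(P_n − Q_n) → 0 for every bounded Lipschitz function f : H → ℝ, then sup_{f ∈ F} |∫ f d(P_n − Q_n)| → 0 for any class F of functions f : H → ℝ that are uniformly bounded (sup_{f∈F} sup_x |f(x)| < ∞) with uniformly bounded Lipschitz constants (sup_{f∈F} ‖f‖_L < ∞). -/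
open MeasureTheory Filter Topology Metric Set

/-- A uniformly bounded, uniformly Lipschitz sequence of functions on a separable space has a
pointwise convergent subsequence. -/
theorem exists_subseq_tendsto_of_lipschitz {H : Type*} [PseudoMetricSpace H]
    [TopologicalSpace.SeparableSpace H] {C : ℝ} {L : NNReal} {f : ℕ → H → ℝ}
    (hb : ∀ n x, |f n x| ≤ C) (hl : ∀ n, LipschitzWith L (f n)) :
    ∃ (g : H → ℝ) (φ : ℕ → ℕ), StrictMono φ ∧
      ∀ x, Tendsto (fun k => f (φ k) x) atTop (𝓝 (g x)) := by
  rcases isEmpty_or_nonempty H with hH | hH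
  · exact ⟨fun _ => 0, id, strictMono_id, fun x => (hH.false x).elim⟩
  set d := TopologicalSpace.denseSeq H
  have hcpt : IsCompact (Set.pi univ fun _ : ℕ => Icc (-C) C) :=
    isCompact_univ_pi fun _ => isCompact_Icc
  obtain ⟨a, -, φ, hφ, hlim⟩ := hcpt.tendsto_subseq (x := fun n i => f n (d i))
    (fun n i _ => abs_le.mp (hb n (d i)))
  rw [tendsto_pi_nhds] at hlim
  have hcauchy : ∀ x, CauchySeq fun k => f (φ k) x := by
    intro x
    rw [Metric.cauchySeq_iff']
    intro ε hε
    have hL : (0 : ℝ) < L + 1 := by positivity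
    obtain ⟨i, hi⟩ := (TopologicalSpace.denseRange_denseSeq H).exists_dist_lt x
      (show 0 < ε / 3 / (L + 1) by positivity)
    obtain ⟨N, hN⟩ := Metric.cauchySeq_iff'.mp (hlim i).cauchySeq (ε / 3) (by positivity)
    refine ⟨N, fun n hn => ?_⟩
    have key : ∀ m, dist (f m x) (f m (d i)) ≤ ε / 3 := by
      intro m
      refine ((hl m).dist_le_mul x (d i)).trans ?_
      rw [lt_div_iff₀ hL] at hi
      nlinarith [dist_nonneg (x := x) (y := d i)]
    have h1 := key (φ n)
    have h2 := key (φ N)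
    rw [dist_comm] at h2
    have h3 := hN n hn
    simp only [Function.comp_apply] at h3
    have h4 := dist_triangle4 (f (φ n) x) (f (φ n) (d i)) (f (φ N) (d i)) (f (φ N) x)
    linarith
  choose g hg using fun x => cauchySeq_tendsto_of_complete (hcauchy x)
  exact ⟨g, φ, hφ, hg⟩

/-- A pointwise limit of `L`-Lipschitz real functions is `L`-Lipschitz. -/
theorem LipschitzWith.of_tendsto_pointwise {H : Type*} [PseudoMetricSpace H] {L : NNReal}
    {f : ℕ → H → ℝ} {g : H → ℝ} (hl : ∀ n, LipschitzWith L (f n))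
    (hg : ∀ x, Tendsto (fun k => f k x) atTop (𝓝 (g x))) : LipschitzWith L g :=
  LipschitzWith.of_dist_le_mul fun x y =>
    le_of_tendsto' ((hg x).dist (hg y)) fun k => (hl k).dist_le_mul x y

theorem LipschitzWith.integrable_of_abs_le {H : Type*} [PseudoMetricSpace H] [MeasurableSpace H]
    [BorelSpace H] {μ : Measure H} [IsFiniteMeasure μ] {f : H → ℝ} {C : ℝ} {L : NNReal}
    (hl : LipschitzWith L f) (hb : ∀ x, |f x| ≤ C) : Integrable f μ :=
  Integrable.of_bound hl.continuous.measurable.aestronglyMeasurable C (Eventually.of_forall hb)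

/-- If `|φ| ≤ θ` outside a measurable set `s` and `|φ| ≤ K` everywhere, then
`|∫ φ| ≤ θ + K μ(s)`. -/
theorem abs_integral_le_add_mul_measureReal {H : Type*} [MeasurableSpace H] {μ : Measure H}
    [IsProbabilityMeasure μ] {φ : H → ℝ} {s : Set H} {θ K : ℝ} (hs : MeasurableSet s)
    (hθ : 0 ≤ θ) (hφ : ∀ x ∉ s, |φ x| ≤ θ) (hK : ∀ x, |φ x| ≤ K) :
    |∫ x, φ x ∂μ| ≤ θ + K * μ.real s := by
  have hi : Integrable (s.indicator fun _ => K) μ := (integrable_const K).indicator hs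
  have h1 : |∫ x, φ x ∂μ| ≤ ∫ x, (θ + s.indicator (fun _ => K) x) ∂μ := by
    rw [← Real.norm_eq_abs]
    refine norm_integral_le_of_norm_le ((integrable_const θ).add hi) (Eventually.of_forall ?_)
    intro x
    by_cases hx : x ∈ s
    · simpa [hx] using (hK x).trans (le_add_of_nonneg_left hθ)
    · simpa [hx] using hφ x hx
  rw [integral_add (integrable_const θ) hi, integral_indicator_const _ hs] at h1
  simpa [mul_comm] using h1

/-- The complements of the `δ`-neighbourhoods of growing initial segments of a dense sequence
have measure tending to zero. -/
theorem tendsto_measureReal_le_infDist_denseSeq {H : Type*} [PseudoMetricSpace H]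
    [TopologicalSpace.SeparableSpace H] [Nonempty H] [MeasurableSpace H] [BorelSpace H]
    (μ : Measure H) [IsFiniteMeasure μ] {δ : ℝ} (hδ : 0 < δ) :
    Tendsto (fun m => μ.real
      {x | δ ≤ infDist x (TopologicalSpace.denseSeq H '' Iic m)}) atTop (𝓝 0) := by
  set d := TopologicalSpace.denseSeq H
  have hne : ∀ m, (d '' Iic m).Nonempty := fun m => (nonempty_Iic).image d
  have hmeas : ∀ m, MeasurableSet {x | δ ≤ infDist x (d '' Iic m)} := fun m =>
    measurableSet_le measurable_const measurable_infDist
  have hanti : Antitone fun m => {x | δ ≤ infDist x (d '' Iic m)} := by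
    intro m m' hm x hx
    exact le_trans hx (infDist_le_infDist_of_subset (image_mono (Iic_subset_Iic.mpr hm)) (hne m))
  have hempty : ⋂ m, {x | δ ≤ infDist x (d '' Iic m)} = ∅ := by
    rw [eq_empty_iff_forall_notMem]
    intro x hx
    obtain ⟨i, hi⟩ := (TopologicalSpace.denseRange_denseSeq H).exists_dist_lt x hδ
    have h1 : δ ≤ infDist x (d '' Iic i) := mem_iInter.mp hx i
    exact absurd (infDist_le_dist_of_mem (mem_image_of_mem d (mem_Iic.mpr le_rfl)))
      (not_le.mpr (hi.trans_le h1))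
  have h := tendsto_measure_iInter_atTop (μ := μ) (fun m => (hmeas m).nullMeasurableSet) hanti
    ⟨0, measure_ne_top _ _⟩
  rw [hempty, measure_empty] at h
  exact (ENNReal.tendsto_toReal ENNReal.zero_ne_top).comp h

/-- Gliding hump: if two sequences of probability measures are asymptotically equal on each bounded
Lipschitz function, they are so along every pointwise null, uniformly bounded and uniformly
Lipschitz sequence of nonnegative functions. -/
theorem tendsto_integral_sub_of_nonneg_of_tendsto_zero
    {H : Type*} [PseudoMetricSpace H] [TopologicalSpace.SeparableSpace H]
    [MeasurableSpace H] [BorelSpace H] {P Q : ℕ → Measure H}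
    [∀ n, IsProbabilityMeasure (P n)] [∀ n, IsProbabilityMeasure (Q n)]
    (h : ∀ f : H → ℝ, (∃ C : ℝ, ∀ x, |f x| ≤ C) → (∃ L : NNReal, LipschitzWith L f) →
      Tendsto (fun n => (∫ x, f x ∂(P n)) - ∫ x, f x ∂(Q n)) atTop (𝓝 0))
    {C : ℝ} {L : NNReal} {g : ℕ → H → ℝ} (h0 : ∀ n x, 0 ≤ g n x) (hb : ∀ n x, g n x ≤ C)
    (hl : ∀ n, LipschitzWith L (g n)) (hg : ∀ x, Tendsto (fun n => g n x) atTop (𝓝 0)) :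
    Tendsto (fun n => (∫ x, g n x ∂(P n)) - ∫ x, g n x ∂(Q n)) atTop (𝓝 0) := by
  have hH : Nonempty H := nonempty_of_isProbabilityMeasure (P 0)
  have hC : 0 ≤ C := (h0 0 hH.some).trans (hb 0 hH.some)
  by_contra hcon
  obtain ⟨ε, hε, hfreq⟩ : ∃ ε > 0, ∃ᶠ n in atTop,
      ε ≤ |(∫ x, g n x ∂(P n)) - ∫ x, g n x ∂(Q n)| := by
    rw [Metric.tendsto_nhds] at hcon
    push Not at hcon
    obtain ⟨ε, hε, hf⟩ := hcon
    refine ⟨ε, hε, ?_⟩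
    simpa [Filter.not_eventually] using hf
  obtain ⟨θ, hθ⟩ : ∃ θ, θ = ε / 8 := ⟨_, rfl⟩
  obtain ⟨δ, hδ⟩ : ∃ δ : ℝ, δ = θ / (4 * (L + 1)) := ⟨_, rfl⟩
  obtain ⟨η, hη⟩ : ∃ η : ℝ, η = θ / (3 * (C + 1)) := ⟨_, rfl⟩
  have hθ0 : 0 < θ := by rw [hθ]; positivity
  have hδ0 : 0 < δ := by rw [hδ]; positivity
  have hη0 : 0 < η := by rw [hη]; positivity
  have hδL : L * (2 * δ) ≤ θ / 2 := by
    have : (L + 1) * (4 * δ) = θ := by rw [hδ]; field_simp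
    nlinarith
  have hηC : 3 * C * η ≤ θ := by
    have : 3 * (C + 1) * η = θ := by rw [hη]; field_simp
    nlinarith
  set d := TopologicalSpace.denseSeq H
  set D : ℕ → H → ℝ := fun m x => infDist x (d '' Iic m)
  have hne : ∀ m, (d '' Iic m).Nonempty := fun m => nonempty_Iic.image d
  have hDanti : ∀ {m m'}, m ≤ m' → ∀ x, D m' x ≤ D m x := fun hm x =>
    infDist_le_infDist_of_subset (image_mono (Iic_subset_Iic.mpr hm)) (hne _)
  set M : NNReal := max L (C / δ).toNNReal with hM
  have hwL : ∀ m, LipschitzWith M fun x => max 0 (2 * C - C / δ * D m x) := by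
    intro m
    have h1 : LipschitzWith M fun x => 2 * C - C / δ * D m x := by
      refine LipschitzWith.of_dist_le_mul fun x y => ?_
      have h2 : dist (D m x) (D m y) ≤ dist x y := by
        simpa using (lipschitz_infDist_pt (d '' Iic m)).dist_le_mul x y
      have h3 : C / δ ≤ M := by
        rw [hM, NNReal.coe_max]
        exact (Real.le_coe_toNNReal _).trans (le_max_right _ _)
      have h4 : dist (2 * C - C / δ * D m x) (2 * C - C / δ * D m y)
          = C / δ * dist (D m x) (D m y) := by
        rw [Real.dist_eq, Real.dist_eq, ← abs_of_nonneg (show 0 ≤ C / δ by positivity),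
          ← abs_mul, abs_of_nonneg (show 0 ≤ C / δ by positivity), abs_sub_comm]
        congr 1; ring
      rw [h4]
      exact mul_le_mul h3 h2 dist_nonneg M.2
    simpa using h1.const_max 0
  have hgL : ∀ n, LipschitzWith M fun x => max 0 (g n x - θ) := by
    intro n
    have h1 : LipschitzWith M fun x => g n x - θ :=
      LipschitzWith.of_dist_le_mul fun x y => by
        rw [dist_sub_right]
        exact ((hl n).weaken (le_max_left _ _)).dist_le_mul x y
    simpa using h1.const_max 0
  -- A state `(n, m, A)`: the last index used, the last neighbourhood index, the current maximum.
  set Inv : ℕ × ℕ × (H → ℝ) → Prop := fun s =>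
    (∀ x, 0 ≤ s.2.2 x) ∧ (∀ x, s.2.2 x ≤ C) ∧ LipschitzWith M s.2.2 ∧
      ∀ x, 2 * δ ≤ D s.2.1 x → s.2.2 x = 0
  have hstep : ∀ s : {s // Inv s}, ∃ t : {t // Inv t},
      s.1.1 < t.1.1 ∧ s.1.2.1 ≤ t.1.2.1 ∧ (∀ x, D s.1.2.1 x < 2 * δ → t.1.2.2 x = s.1.2.2 x) ∧
      (∀ x, D t.1.2.1 x < δ → |t.1.2.2 x - s.1.2.2 x - g t.1.1 x| ≤ θ) ∧
      |(∫ x, s.1.2.2 x ∂(P t.1.1)) - ∫ x, s.1.2.2 x ∂(Q t.1.1)| < θ ∧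
      (P t.1.1).real {x | δ ≤ D t.1.2.1 x} < η ∧ (Q t.1.1).real {x | δ ≤ D t.1.2.1 x} < η ∧
      ε ≤ |(∫ x, g t.1.1 x ∂(P t.1.1)) - ∫ x, g t.1.1 x ∂(Q t.1.1)| := by
    rintro ⟨⟨n₀, m₀, A⟩, hA0, hAC, hAL, hAz⟩
    simp only at hA0 hAC hAL hAz ⊢
    have e1 : ∀ᶠ n in atTop, |(∫ x, A x ∂(P n)) - ∫ x, A x ∂(Q n)| < θ := by
      have := h A ⟨C, fun x => abs_le.mpr ⟨by linarith [hA0 x], hAC x⟩⟩ ⟨M, hAL⟩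
      simpa using Metric.tendsto_nhds.mp this θ hθ0
    have e2 : ∀ᶠ n in atTop, ∀ i ∈ Iic m₀, g n (d i) < θ / 2 := by
      rw [Filter.eventually_all_finite (finite_Iic m₀)]
      exact fun i _ => (hg (d i)).eventually_lt_const (by positivity)
    obtain ⟨n, hn, hA, hgn, hn₀⟩ :=
      (hfreq.and_eventually (e1.and (e2.and (eventually_gt_atTop n₀)))).exists
    obtain ⟨m, hPm, hQm, hm⟩ :=
      (((tendsto_measureReal_le_infDist_denseSeq (P n) hδ0).eventually_lt_const hη0).and
      (((tendsto_measureReal_le_infDist_denseSeq (Q n) hδ0).eventually_lt_const hη0).and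
        (eventually_ge_atTop m₀))).exists
    have hsmall : ∀ x, D m₀ x < 2 * δ → g n x ≤ θ := by
      intro x hx
      obtain ⟨_, ⟨i, hi, rfl⟩, hxi⟩ := (infDist_lt_iff (hne m₀)).mp hx
      have h1 := hgn i hi
      have h2 := (hl n).dist_le_mul x (d i)
      have h3 : (L : ℝ) * dist x (d i) ≤ L * (2 * δ) := by gcongr
      rw [Real.dist_eq] at h2
      linarith [le_abs_self (g n x - g n (d i))]
    have hsame : ∀ x, D m₀ x < 2 * δ →
        max (A x) (min (max 0 (g n x - θ)) (max 0 (2 * C - C / δ * D m x))) = A x := by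
      intro x hx
      rw [max_eq_left (sub_nonpos.mpr (hsmall x hx)), min_eq_left (le_max_left _ _),
        max_eq_left (hA0 x)]
    refine ⟨⟨(n, m, fun x => max (A x)
      (min (max 0 (g n x - θ)) (max 0 (2 * C - C / δ * D m x)))), ?_, ?_, ?_, ?_⟩,
      hn₀, hm, hsame, ?_, hA, hPm, hQm, hn⟩
    · exact fun x => (hA0 x).trans (le_max_left _ _)
    · exact fun x => max_le (hAC x) ((min_le_left _ _).trans
        (max_le hC (by linarith [hb n x])))
    · simpa using hAL.max ((hgL n).min (hwL m))
    · intro x hx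
      simp only at hx ⊢
      have h1 : 2 * C - C / δ * D m x ≤ 0 := by
        have : C / δ * (2 * δ) ≤ C / δ * D m x := by gcongr
        have h2 : C / δ * (2 * δ) = 2 * C := by field_simp
        linarith
      rw [hAz x (hx.trans (hDanti hm x)), max_eq_left h1, min_eq_right (le_max_left _ _), max_self]
    · intro x hx
      simp only at hx ⊢
      rcases lt_or_ge (D m₀ x) (2 * δ) with hlt | hge
      · rw [hsame x hlt, sub_self, zero_sub, abs_neg, abs_of_nonneg (h0 n x)]
        exact hsmall x hlt
      · have h1 : C ≤ 2 * C - C / δ * D m x := by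
          have : C / δ * D m x ≤ C / δ * δ := by gcongr
          have h2 : C / δ * δ = C := by field_simp
          linarith
        have h2 : max 0 (g n x - θ) ≤ max 0 (2 * C - C / δ * D m x) :=
          max_le_max le_rfl (by linarith [hb n x])
        rw [hAz x hge, min_eq_left h2, max_eq_right (le_max_left _ _), abs_le]
        have := h0 n x
        rcases max_cases 0 (g n x - θ) with ⟨e, _⟩ | ⟨e, _⟩ <;> rw [e] <;>
          constructor <;> linarith
  choose step hs1 hs2 hs3 hs4 hs5 hs6 hs7 hs8 using hstep
  have hinit : Inv (0, 0, fun _ => 0) :=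
    ⟨fun _ => le_rfl, fun _ => hC, LipschitzWith.const' 0, fun _ _ => rfl⟩
  set u : ℕ → {s // Inv s} := fun k => step^[k] ⟨_, hinit⟩
  have husucc : ∀ k, u (k + 1) = step (u k) := fun k => Function.iterate_succ_apply' _ _ _
  have humono : Monotone fun k => (u k).1.2.1 :=
    monotone_nat_of_le_succ fun k => by rw [husucc]; exact hs2 _
  have hun : ∀ k, k ≤ (u k).1.1 := by
    intro k
    induction k with
    | zero => exact Nat.zero_le _
    | succ k ih => rw [husucc]; exact ih.trans_lt (hs1 _)
  have hstable : ∀ k j, k ≤ j → ∀ x, D (u k).1.2.1 x < 2 * δ →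
      (u j).1.2.2 x = (u k).1.2.2 x := by
    intro k j hkj x hx
    induction j, hkj using Nat.le_induction with
    | base => rfl
    | succ j hkj ih =>
      rw [husucc, hs3 _ x ((hDanti (humono hkj) x).trans_lt hx), ih]
  have hlim : ∀ x, ∃ a, Tendsto (fun k => (u k).1.2.2 x) atTop (𝓝 a) := by
    intro x
    have hmon : Monotone fun k => (u k).1.2.2 x := by
      refine monotone_nat_of_le_succ fun k => ?_
      rcases lt_or_ge (D (u k).1.2.1 x) (2 * δ) with hlt | hge
      · exact (hstable k (k + 1) k.le_succ x hlt).ge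
      · rw [(u k).2.2.2.2 x hge]
        exact (u (k + 1)).2.1 x
    exact ⟨_, tendsto_atTop_ciSup hmon ⟨C, by rintro _ ⟨k, rfl⟩; exact (u k).2.2.1 x⟩⟩
  choose f hf using hlim
  have hf0 : ∀ x, 0 ≤ f x := fun x => ge_of_tendsto' (hf x) fun k => (u k).2.1 x
  have hfC : ∀ x, f x ≤ C := fun x => le_of_tendsto' (hf x) fun k => (u k).2.2.1 x
  have hfL : LipschitzWith M f := LipschitzWith.of_tendsto_pointwise (fun k => (u k).2.2.2.1) hf
  have hfabs : ∀ x, |f x| ≤ C := fun x => abs_le.mpr ⟨by linarith [hf0 x], hfC x⟩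
  have hftend := h f ⟨C, hfabs⟩ ⟨M, hfL⟩
  obtain ⟨N, hN⟩ := eventually_atTop.mp (Metric.tendsto_nhds.mp hftend θ hθ0)
  have hNn := hN (u (N + 1)).1.1 (N.le_succ.trans (hun _))
  have hlast : ∀ x, D (u (N + 1)).1.2.1 x < 2 * δ → f x = (u (N + 1)).1.2.2 x := fun x hx =>
    tendsto_nhds_unique (hf x) (tendsto_atTop_of_eventually_const (i₀ := N + 1)
      fun j hj => hstable _ j hj x hx)
  have h4 := hs4 (u N)
  have h5 := hs5 (u N)
  have h6 := hs6 (u N)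
  have h7 := hs7 (u N)
  have h8 := hs8 (u N)
  rw [← husucc] at h4 h5 h6 h7 h8
  have hA0 := (u N).2.1
  have hAC := (u N).2.2.1
  have hAL := (u N).2.2.2.1
  generalize (u N).1.2.2 = A at h4 h5 hA0 hAC hAL
  generalize (u (N + 1)).1.2.2 = A' at h4 hlast
  generalize (u (N + 1)).1.2.1 = m at h4 h6 h7 hlast
  generalize (u (N + 1)).1.1 = n at h4 h5 h6 h7 h8 hNn
  have hmeas : MeasurableSet {x | δ ≤ D m x} :=
    measurableSet_le measurable_const measurable_infDist
  have hin : ∀ x ∉ {x | δ ≤ D m x}, |f x - A x - g n x| ≤ θ := by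
    intro x hx
    have hx' : D m x < δ := not_le.mp hx
    rw [hlast x (by linarith)]
    exact h4 x hx'
  have hall : ∀ x, |f x - A x - g n x| ≤ 3 * C := by
    intro x
    have := hf0 x; have := hfC x; have := hA0 x; have := hAC x; have := h0 n x; have := hb n x
    exact abs_le.mpr ⟨by linarith, by linarith⟩
  have hbound : ∀ (μ : Measure H) [IsProbabilityMeasure μ], μ.real {x | δ ≤ D m x} < η →
      |(∫ x, f x ∂μ) - (∫ x, A x ∂μ) - ∫ x, g n x ∂μ| ≤ 2 * θ := by
    intro μ _ hμ
    have hfi : Integrable f μ := hfL.integrable_of_abs_le hfabs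
    have hAi : Integrable A μ := hAL.integrable_of_abs_le (C := C)
      fun x => abs_le.mpr ⟨by linarith [hA0 x], hAC x⟩
    have hgi : Integrable (g n) μ := (hl n).integrable_of_abs_le (C := C)
      fun x => abs_le.mpr ⟨by linarith [h0 n x], hb n x⟩
    have h1 := abs_integral_le_add_mul_measureReal (μ := μ) hmeas hθ0.le hin hall
    have h3 : ∫ x, (f x - A x - g n x) ∂μ
        = (∫ x, f x ∂μ) - (∫ x, A x ∂μ) - ∫ x, g n x ∂μ := by
      rw [← integral_sub hfi hAi]
      exact integral_sub (hfi.sub hAi) hgi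
    rw [h3] at h1
    have h2 : 3 * C * μ.real {x | δ ≤ D m x} ≤ 3 * C * η := by gcongr
    linarith
  have hP := abs_le.mp (hbound (P n) h6)
  have hQ := abs_le.mp (hbound (Q n) h7)
  rw [Real.dist_eq, sub_zero] at hNn
  have h5' := abs_lt.mp h5
  have hNn' := abs_lt.mp hNn
  rcases le_abs.mp h8 with h9 | h9 <;> linarith [hP.1, hP.2, hQ.1, hQ.2, h5'.1, h5'.2,
    hNn'.1, hNn'.2]

/-- The signed version of `tendsto_integral_sub_of_nonneg_of_tendsto_zero`. -/
theorem tendsto_integral_sub_of_tendsto_zero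
    {H : Type*} [PseudoMetricSpace H] [TopologicalSpace.SeparableSpace H]
    [MeasurableSpace H] [BorelSpace H] {P Q : ℕ → Measure H}
    [∀ n, IsProbabilityMeasure (P n)] [∀ n, IsProbabilityMeasure (Q n)]
    (h : ∀ f : H → ℝ, (∃ C : ℝ, ∀ x, |f x| ≤ C) → (∃ L : NNReal, LipschitzWith L f) →
      Tendsto (fun n => (∫ x, f x ∂(P n)) - ∫ x, f x ∂(Q n)) atTop (𝓝 0))
    {C : ℝ} {L : NNReal} {g : ℕ → H → ℝ} (hb : ∀ n x, |g n x| ≤ C)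
    (hl : ∀ n, LipschitzWith L (g n)) (hg : ∀ x, Tendsto (fun n => g n x) atTop (𝓝 0)) :
    Tendsto (fun n => (∫ x, g n x ∂(P n)) - ∫ x, g n x ∂(Q n)) atTop (𝓝 0) := by
  have hpos : ∀ g : ℕ → H → ℝ, (∀ n x, |g n x| ≤ C) → (∀ n, LipschitzWith L (g n)) →
      (∀ x, Tendsto (fun n => g n x) atTop (𝓝 0)) →
      Tendsto (fun n => (∫ x, max (g n x) 0 ∂(P n)) - ∫ x, max (g n x) 0 ∂(Q n))
        atTop (𝓝 0) := by
    intro g hb hl hg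
    refine tendsto_integral_sub_of_nonneg_of_tendsto_zero h (C := C) (L := L)
      (fun n x => le_max_right _ _) (fun n x => max_le ((le_abs_self _).trans (hb n x))
        ((abs_nonneg _).trans (hb n x))) (fun n => (hl n).max_const 0) fun x => ?_
    simpa using (hg x).max (tendsto_const_nhds (x := (0 : ℝ)))
  have h1 := hpos g hb hl hg
  have h2 := hpos (fun n x => -g n x) (by simpa using hb) (fun n => (hl n).neg)
    fun x => by simpa using (hg x).neg
  have hsplit : ∀ (μ : Measure H) [IsProbabilityMeasure μ] (n : ℕ),
      ∫ x, g n x ∂μ = (∫ x, max (g n x) 0 ∂μ) - ∫ x, max (-g n x) 0 ∂μ := by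
    intro μ _ n
    have hi : Integrable (g n) μ := (hl n).integrable_of_abs_le (hb n)
    rw [← integral_sub hi.pos_part hi.neg_part]
    refine integral_congr_ae (Eventually.of_forall fun x => ?_)
    simp only
    rcases le_total (g n x) 0 with hx | hx <;> simp [hx]
  have h3 := h1.sub h2
  rw [sub_zero] at h3
  refine h3.congr fun n => ?_
  rw [hsplit (P n) n, hsplit (Q n) n]
  ring

/-- **Corollary 1.** If `∫ f d(Pₙ − Qₙ) → 0` for every bounded Lipschitz
`f : H → ℝ`, then `sup_{f ∈ F} |∫ f d(Pₙ − Qₙ)| → 0` for any class `F` of uniformly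
bounded functions with uniformly bounded Lipschitz constants. -/
theorem uniform_convergence_on_lipschitz_class
    {H : Type*} [MetricSpace H] [CompleteSpace H] [TopologicalSpace.SeparableSpace H]
    [MeasurableSpace H] [BorelSpace H]
    (P Q : ℕ → Measure H)
    [∀ n, IsProbabilityMeasure (P n)] [∀ n, IsProbabilityMeasure (Q n)]
    (h : ∀ f : H → ℝ, (∃ C : ℝ, ∀ x, |f x| ≤ C) → (∃ L : NNReal, LipschitzWith L f) →
      Tendsto (fun n => (∫ x, f x ∂(P n)) - ∫ x, f x ∂(Q n)) atTop (𝓝 0))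
    (F : Set (H → ℝ))
    (hbdd : ∃ C : ℝ, ∀ f ∈ F, ∀ x, |f x| ≤ C)
    (hlip : ∃ L : NNReal, ∀ f ∈ F, LipschitzWith L f) :
    Tendsto (fun n => sSup ((fun f : H → ℝ =>
        |(∫ x, f x ∂(P n)) - ∫ x, f x ∂(Q n)|) '' F)) atTop (𝓝 0) := by
  rcases F.eq_empty_or_nonempty with rfl | hF
  · simp
  obtain ⟨C, hC⟩ := hbdd
  obtain ⟨L, hL⟩ := hlip
  have hnear : ∀ n : ℕ, ∃ f ∈ F, sSup ((fun f : H → ℝ =>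
      |(∫ x, f x ∂(P n)) - ∫ x, f x ∂(Q n)|) '' F) - 1 / ((n : ℝ) + 1) <
      |(∫ x, f x ∂(P n)) - ∫ x, f x ∂(Q n)| := by
    intro n
    obtain ⟨_, ⟨f, hf, rfl⟩, hlt⟩ := exists_lt_of_lt_csSup
      (hF.image fun f : H → ℝ => |(∫ x, f x ∂(P n)) - ∫ x, f x ∂(Q n)|)
      (sub_lt_self _ (Nat.one_div_pos_of_nat (α := ℝ) (n := n)))
    exact ⟨f, hf, hlt⟩
  choose f hfF hf using hnear
  refine tendsto_of_subseq_tendsto fun ns hns => ?_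
  obtain ⟨f', φ, hφ, hlim⟩ := exists_subseq_tendsto_of_lipschitz
    (f := fun k => f (ns k)) (fun k => hC _ (hfF _)) (fun k => hL _ (hfF _))
  have hns' : Tendsto (fun k => ns (φ k)) atTop atTop := hns.comp hφ.tendsto_atTop
  have hf'C : ∀ x, |f' x| ≤ C := fun x =>
    le_of_tendsto' (hlim x).abs fun k => hC _ (hfF _) x
  have hf'L : LipschitzWith L f' :=
    LipschitzWith.of_tendsto_pointwise (fun k => hL _ (hfF (ns (φ k)))) hlim
  have h1 := (h f' ⟨C, hf'C⟩ ⟨L, hf'L⟩).comp hns'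
  have h2 := tendsto_integral_sub_of_tendsto_zero
    (P := fun k => P (ns (φ k))) (Q := fun k => Q (ns (φ k)))
    (g := fun k x => f (ns (φ k)) x - f' x) (C := C + C) (L := L + L)
    (fun g hgb hgl => (h g hgb hgl).comp hns')
    (fun k x => (abs_sub _ _).trans (add_le_add (hC _ (hfF _) x) (hf'C x)))
    (fun k => (hL _ (hfF _)).sub hf'L)
    (fun x => by simpa using (hlim x).sub_const (f' x))
  have h3 := ((h1.add h2).abs).add
    ((tendsto_one_div_add_atTop_nhds_zero_nat (𝕜 := ℝ)).comp hns')
  simp only [add_zero, abs_zero] at h3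
  refine ⟨φ, squeeze_zero (fun k => Real.sSup_nonneg ?_) (fun k => ?_) h3⟩
  · rintro _ ⟨g, -, rfl⟩
    exact abs_nonneg _
  · have hi : ∀ (μ : Measure H) [IsProbabilityMeasure μ],
        ∫ x, (f (ns (φ k)) x - f' x) ∂μ = (∫ x, f (ns (φ k)) x ∂μ) - ∫ x, f' x ∂μ :=
      fun μ _ => integral_sub ((hL _ (hfF _)).integrable_of_abs_le (hC _ (hfF _)))
        (hf'L.integrable_of_abs_le hf'C)
    have h4 := (hf (ns (φ k))).le
    simp only [Function.comp_apply]
    rw [hi, hi, show ∀ a b c d : ℝ, a - b + (c - a - (d - b)) = c - d by intros; ring]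
    linarith
end

section
/- Let (H, ρ) be a complete separable metric space and let {P_n}, {Q_n} be sequences of Borel probability measures on H. If ∫ f d(P_n − Q_n) → 0 for every bounded uniformly continuous function f : H → ℝ, then sup_{f ∈ F} |∫ f d(P_n − Q_n)| → 0 for any class F of functions f : H → ℝ that are uniformly bounded (sup_{f∈F} sup_x |f(x)| < ∞) and uniformly equicontinuous (ω_F(h) := sup_{f∈F} ω_f(h) → 0 as h → 0). -/
open MeasureTheory Filter Topology Metric Set

/-- The modulus of continuity `ω_f(h) = sup {|f x − f y| : ρ(x,y) ≤ h}` of `f : H → ℝ`. -/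
noncomputable def modCont {H : Type*} [MetricSpace H] (f : H → ℝ) (h : ℝ) : ℝ :=
  sSup {d : ℝ | ∃ x y : H, dist x y ≤ h ∧ d = |f x - f y|}

/-- Bounded uniformly continuous real functions. -/
def IsBUC {H : Type*} [MetricSpace H] (f : H → ℝ) : Prop :=
  UniformContinuous f ∧ ∃ C : ℝ, ∀ x, |f x| ≤ C

theorem IsBUC.add {H : Type*} [MetricSpace H] {f g : H → ℝ} (hf : IsBUC f) (hg : IsBUC g) :
    IsBUC (fun x => f x + g x) := by
  obtain ⟨hf, A, hA⟩ := hf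
  obtain ⟨hg, B, hB⟩ := hg
  exact ⟨hf.add hg, A + B, fun x => (abs_add_le _ _).trans (add_le_add (hA x) (hB x))⟩

theorem IsBUC.sub {H : Type*} [MetricSpace H] {f g : H → ℝ} (hf : IsBUC f) (hg : IsBUC g) :
    IsBUC (fun x => f x - g x) := by
  obtain ⟨hf, A, hA⟩ := hf
  obtain ⟨hg, B, hB⟩ := hg
  exact ⟨hf.sub hg, A + B, fun x => (abs_sub _ _).trans (add_le_add (hA x) (hB x))⟩

theorem IsBUC.integrable {H : Type*} [MetricSpace H] [MeasurableSpace H] [BorelSpace H]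
    {f : H → ℝ} (hf : IsBUC f) (μ : Measure H) [IsFiniteMeasure μ] : Integrable f μ := by
  obtain ⟨hf, A, hA⟩ := hf
  exact Integrable.of_bound hf.continuous.measurable.aestronglyMeasurable A
    (Eventually.of_forall hA)

/-- Uniform equicontinuity, extracted from the convergence of the supremum of the moduli. -/
theorem exists_forall_abs_sub_lt_of_tendsto_sSup_modCont {H : Type*} [MetricSpace H]
    {F : Set (H → ℝ)} {C : ℝ} (hC : ∀ f ∈ F, ∀ x, |f x| ≤ C)
    (hequi : Tendsto (fun t => sSup ((fun f : H → ℝ => modCont f t) '' F)) (𝓝[≥] 0) (𝓝 0))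
    {e : ℝ} (he : 0 < e) :
    ∃ t > 0, ∀ f ∈ F, ∀ x y, dist x y ≤ t → |f x - f y| < e := by
  have h1 : ∀ᶠ t in 𝓝[>] (0 : ℝ), sSup ((fun f : H → ℝ => modCont f t) '' F) < e :=
    (hequi.mono_left (nhdsWithin_mono _ Ioi_subset_Ici_self)).eventually (gt_mem_nhds he)
  obtain ⟨t, ht, ht0⟩ := (h1.and self_mem_nhdsWithin).exists
  refine ⟨t, ht0, fun f hf x y hxy => lt_of_le_of_lt ?_ ht⟩
  have hd : ∀ f ∈ F, ∀ x y, |f x - f y| ≤ C + C := fun f hf x y =>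
    (abs_sub _ _).trans (add_le_add (hC f hf x) (hC f hf y))
  have hCC : 0 ≤ C + C := (abs_nonneg _).trans (hd f hf x y)
  have h2 : |f x - f y| ≤ modCont f t := by
    refine le_csSup ⟨C + C, ?_⟩ ⟨x, y, hxy, rfl⟩
    rintro _ ⟨x, y, -, rfl⟩
    exact hd f hf x y
  refine h2.trans (le_csSup ⟨C + C, ?_⟩ (mem_image_of_mem _ hf))
  rintro _ ⟨g, hg, rfl⟩
  refine Real.sSup_le ?_ hCC
  rintro _ ⟨x, y, -, rfl⟩
  exact hd g hg x y

theorem abs_integral_sub_integral_le {H : Type*} [MeasurableSpace H] (μ ν : Measure H)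
    [IsProbabilityMeasure μ] [IsProbabilityMeasure ν] {f : H → ℝ} {a : ℝ}
    (hf : ∀ x, |f x| ≤ a) : |(∫ x, f x ∂μ) - ∫ x, f x ∂ν| ≤ 2 * a := by
  have key : ∀ (m : Measure H) [IsProbabilityMeasure m], |∫ x, f x ∂m| ≤ a := fun m _ => by
    simpa using norm_integral_le_of_norm_le_const (μ := m) (f := f) (C := a) (Eventually.of_forall hf)
  have := (abs_sub (∫ x, f x ∂μ) (∫ x, f x ∂ν)).trans (add_le_add (key μ) (key ν))
  linarith

theorem abs_integral_le_of_eq_zero_off {H : Type*} [MeasurableSpace H] (μ : Measure H)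
    [IsFiniteMeasure μ] {f : H → ℝ} {a η : ℝ} {s : Set H} (ha : 0 ≤ a)
    (hf : ∀ x, |f x| ≤ a) (hs : ∀ x ∉ s, f x = 0) (hμ : μ.real s ≤ η) :
    |∫ x, f x ∂μ| ≤ a * η := by
  rw [← setIntegral_eq_integral_of_forall_compl_eq_zero (s := s) hs]
  have := norm_setIntegral_le_of_norm_le_const (μ := μ) (s := s) (f := f) (C := a)
    (measure_lt_top μ s) (fun x _ => hf x)
  exact this.trans (mul_le_mul_of_nonneg_left hμ ha)

theorem abs_integral_sub_integral_le_of_eq_zero_off {H : Type*} [MeasurableSpace H]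
    (μ ν : Measure H) [IsFiniteMeasure μ] [IsFiniteMeasure ν] {f : H → ℝ} {a η : ℝ} {s : Set H}
    (ha : 0 ≤ a) (hf : ∀ x, |f x| ≤ a) (hs : ∀ x ∉ s, f x = 0)
    (hμ : μ.real s ≤ η) (hν : ν.real s ≤ η) :
    |(∫ x, f x ∂μ) - ∫ x, f x ∂ν| ≤ 2 * (a * η) := by
  have := (abs_sub (∫ x, f x ∂μ) (∫ x, f x ∂ν)).trans
    (add_le_add (abs_integral_le_of_eq_zero_off μ ha hf hs hμ)
      (abs_integral_le_of_eq_zero_off ν ha hf hs hν))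
  linarith

/-- The distance to the first `N + 1` points of a sequence. -/
noncomputable def headDist {H : Type*} [MetricSpace H] (d : ℕ → H) (N : ℕ) (x : H) : ℝ :=
  infDist x (d '' Iic N)

theorem headDist_antitone {H : Type*} [MetricSpace H] (d : ℕ → H) (x : H) :
    Antitone fun N => headDist d N x := fun _ _ hMN =>
  infDist_le_infDist_of_subset (image_mono (Iic_subset_Iic.2 hMN)) (nonempty_Iic.image d)

theorem headDist_le_add_dist {H : Type*} [MetricSpace H] (d : ℕ → H) (N : ℕ) (x y : H) :
    headDist d N x ≤ headDist d N y + dist x y :=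
  infDist_le_infDist_add_dist

theorem continuous_headDist {H : Type*} [MetricSpace H] (d : ℕ → H) (N : ℕ) :
    Continuous (headDist d N) :=
  continuous_infDist_pt _

theorem exists_dist_lt_of_headDist_lt {H : Type*} [MetricSpace H] {d : ℕ → H} {N : ℕ} {x : H}
    {r : ℝ} (h : headDist d N x < r) : ∃ i ≤ N, dist x (d i) < r := by
  obtain ⟨_, ⟨i, hi, rfl⟩, hy⟩ := (infDist_lt_iff (nonempty_Iic.image d)).1 h
  exact ⟨i, hi, hy⟩

/-- The points at distance at least `r` from the first points of a dense sequence eventually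
have small mass. -/
theorem eventually_measureReal_le_headDist_le {H : Type*} [MetricSpace H] [MeasurableSpace H]
    [BorelSpace H] (μ : Measure H) [IsFiniteMeasure μ] {d : ℕ → H} (hd : DenseRange d)
    {r η : ℝ} (hr : 0 < r) (hη : 0 < η) :
    ∀ᶠ N in atTop, μ.real {x | r ≤ headDist d N x} ≤ η := by
  have hanti : Antitone fun N => {x | r ≤ headDist d N x} := fun M N hMN x hx =>
    le_trans hx (headDist_antitone d x hMN)
  have hinter : ⋂ N, {x | r ≤ headDist d N x} = ∅ := by
    refine eq_empty_of_forall_notMem fun x hx => ?_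
    obtain ⟨i, hi⟩ := hd.exists_dist_lt x hr
    have h1 : r ≤ headDist d i x := mem_iInter.1 hx i
    have h2 : headDist d i x ≤ dist x (d i) :=
      infDist_le_dist_of_mem (mem_image_of_mem d self_mem_Iic)
    linarith
  have h1 := tendsto_measure_iInter_atTop (μ := μ)
    (fun N => (isClosed_le continuous_const
      (continuous_headDist d N)).measurableSet.nullMeasurableSet) hanti
    ⟨0, measure_ne_top _ _⟩
  rw [hinter, measure_empty] at h1
  have h2 := (ENNReal.tendsto_toReal ENNReal.zero_ne_top).comp h1
  exact (h2.eventually (gt_mem_nhds (by simpa using hη))).mono fun N hN => le_of_lt hN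

/-- A uniformly bounded class is totally bounded for uniform convergence on finitely many
points. -/
theorem exists_finite_approx {H : Type*} {F : Set (H → ℝ)} {C : ℝ}
    (hC : ∀ f ∈ F, ∀ x, |f x| ≤ C) (d : ℕ → H) (N : ℕ) {δ : ℝ} (hδ : 0 < δ) :
    ∃ T ⊆ F, T.Finite ∧ ∀ f ∈ F, ∃ g ∈ T, ∀ i ≤ N, |f (d i) - g (d i)| < δ := by
  set e : (H → ℝ) → (Fin (N + 1) → ℝ) := fun f i => f (d i)
  have hsub : e '' F ⊆ Set.pi univ fun _ => Icc (-C) C := by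
    rintro _ ⟨f, hf, rfl⟩ i -
    exact abs_le.1 (hC f hf _)
  have htb : TotallyBounded (e '' F) :=
    ((isCompact_univ_pi fun _ => isCompact_Icc).totallyBounded).subset hsub
  obtain ⟨t, htF, htfin, ht⟩ := finite_approx_of_totallyBounded htb δ hδ
  obtain ⟨T, hTF, hTfin, rfl⟩ := exists_subset_image_finite_and.1 ⟨t, htF, htfin, rfl⟩
  refine ⟨T, hTF, hTfin, fun f hf => ?_⟩
  have := ht (mem_image_of_mem e hf)
  simp only [mem_iUnion] at this
  obtain ⟨_, ⟨g, hg, rfl⟩, hfg⟩ := this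
  refine ⟨g, hg, fun i hi => ?_⟩
  exact (dist_pi_lt_iff hδ).1 hfg ⟨i, Nat.lt_succ_of_le hi⟩

/-- Soft thresholding at level `c`. -/
noncomputable def softThreshold (c v : ℝ) : ℝ := v - max (-c) (min c v)

theorem softThreshold_eq_zero {c v : ℝ} (h : |v| ≤ c) : softThreshold c v = 0 := by
  obtain ⟨h1, h2⟩ := abs_le.1 h
  simp [softThreshold, h1, h2]

theorem abs_softThreshold_le {c : ℝ} (hc : 0 ≤ c) (v : ℝ) : |softThreshold c v| ≤ |v| := by
  unfold softThreshold
  grind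

theorem abs_sub_softThreshold_le {c : ℝ} (hc : 0 ≤ c) (v : ℝ) :
    |v - softThreshold c v| ≤ c := by
  unfold softThreshold
  grind

theorem abs_softThreshold_sub_le {c : ℝ} (hc : 0 ≤ c) (v w : ℝ) :
    |softThreshold c v - softThreshold c w| ≤ |v - w| := by
  unfold softThreshold
  grind

/-- A cutoff equal to `1` up to `r` and to `0` from `2 * r` on. -/
noncomputable def cutoff (r s : ℝ) : ℝ := max 0 (min 1 (2 - s / r))

theorem cutoff_nonneg (r s : ℝ) : 0 ≤ cutoff r s := le_max_left _ _

theorem cutoff_le_one (r s : ℝ) : cutoff r s ≤ 1 := max_le zero_le_one (min_le_left _ _)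

theorem cutoff_eq_one {r s : ℝ} (hr : 0 < r) (hs : s ≤ r) : cutoff r s = 1 := by
  have : s / r ≤ 1 := (div_le_one hr).2 hs
  unfold cutoff
  grind

theorem cutoff_eq_zero {r s : ℝ} (hr : 0 < r) (hs : 2 * r ≤ s) : cutoff r s = 0 := by
  have : 2 ≤ s / r := (le_div_iff₀ hr).2 hs
  unfold cutoff
  grind

theorem abs_cutoff_sub_le {r : ℝ} (hr : 0 < r) (s t : ℝ) :
    |cutoff r s - cutoff r t| ≤ |s - t| / r := by
  have h : |s - t| / r = |s / r - t / r| := by rw [← sub_div, abs_div, abs_of_pos hr]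
  rw [h, cutoff, cutoff]
  generalize s / r = a
  generalize t / r = b
  clear h hr
  grind

/-- The signed integral of `f` against the difference of two measures. -/
noncomputable def intDiff {H : Type*} [MeasurableSpace H] (μ ν : Measure H) (f : H → ℝ) : ℝ :=
  (∫ x, f x ∂μ) - ∫ x, f x ∂ν

theorem intDiff_sub {H : Type*} [MetricSpace H] [MeasurableSpace H] [BorelSpace H]
    (μ ν : Measure H) [IsFiniteMeasure μ] [IsFiniteMeasure ν] {f g : H → ℝ}
    (hf : IsBUC f) (hg : IsBUC g) :
    intDiff μ ν (fun x => f x - g x) = intDiff μ ν f - intDiff μ ν g := by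
  unfold intDiff
  rw [integral_sub (hf.integrable μ) (hg.integrable μ),
    integral_sub (hf.integrable ν) (hg.integrable ν)]
  ring

/-- The oscillation of `u` is controlled by two members of `F` and a Lipschitz term. -/
def ControlledBy {H : Type*} [MetricSpace H] (F : Set (H → ℝ)) (K : ℝ) (u : H → ℝ) : Prop :=
  ∃ f ∈ F, ∃ g ∈ F, ∀ x y, |u x - u y| ≤ |f x - f y| + |g x - g y| + K * dist x y

/-- Uniform equicontinuity of a class, in `ε`-`δ` form. -/
def IsUniformEquicont {H : Type*} [MetricSpace H] (F : Set (H → ℝ)) : Prop :=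
  ∀ e > 0, ∃ t > 0, ∀ f ∈ F, ∀ x y, dist x y ≤ t → |f x - f y| < e

theorem IsUniformEquicont.controlledBy {H : Type*} [MetricSpace H] {F : Set (H → ℝ)}
    (hF : IsUniformEquicont F) {K : ℝ} (hK : 0 ≤ K) {e : ℝ} (he : 0 < e) :
    ∃ t > 0, ∀ u, ControlledBy F K u → ∀ x y, dist x y < t → |u x - u y| < e := by
  obtain ⟨t, ht, h⟩ := hF (e / 4) (by positivity)
  refine ⟨min t (e / (4 * (K + 1))), by positivity, ?_⟩
  rintro u ⟨f, hf, g, hg, hu⟩ x y hxy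
  have h1 := h f hf x y (hxy.le.trans (min_le_left _ _))
  have h2 := h g hg x y (hxy.le.trans (min_le_left _ _))
  have h3 := (lt_div_iff₀ (by positivity)).1 (hxy.trans_le (min_le_right _ _))
  have h4 : 0 ≤ dist x y := dist_nonneg
  have h5 := hu x y
  nlinarith

theorem ControlledBy.isBUC {H : Type*} [MetricSpace H] {F : Set (H → ℝ)}
    (hF : IsUniformEquicont F) {K C : ℝ} (hK : 0 ≤ K) {u : H → ℝ} (hu : ControlledBy F K u)
    (hC : ∀ x, |u x| ≤ C) : IsBUC u := by
  refine ⟨Metric.uniformContinuous_iff.2 fun e he => ?_, C, hC⟩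
  obtain ⟨t, ht, h⟩ := hF.controlledBy hK he
  exact ⟨t, ht, fun {x y} hxy => h u hu x y hxy⟩

/-- The basic step of the gliding hump construction. -/
theorem exists_hump {H : Type*} [MetricSpace H] [MeasurableSpace H] [BorelSpace H]
    (P Q : ℕ → Measure H)
    [∀ n, IsProbabilityMeasure (P n)] [∀ n, IsProbabilityMeasure (Q n)]
    (h : ∀ f : H → ℝ, IsBUC f → Tendsto (fun n => intDiff (P n) (Q n) f) atTop (𝓝 0))
    {F : Set (H → ℝ)} {C : ℝ} (hC0 : 0 < C) (hC : ∀ f ∈ F, ∀ x, |f x| ≤ C)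
    (hF : IsUniformEquicont F) {d : ℕ → H} (hd : DenseRange d) {r δ : ℝ} (hr : 0 < r)
    (hδ : 0 < δ) (hosc : ∀ f ∈ F, ∀ x y, dist x y ≤ 4 * r → |f x - f y| < δ)
    (hbig : ∀ m, ∃ n > m, ∃ f ∈ F, 100 * δ ≤ |intDiff (P n) (Q n) f|)
    (N m : ℕ) {G : H → ℝ} (hG : IsBUC G) :
    ∃ n > m, ∃ N' ≥ N, ∃ u : H → ℝ, ControlledBy F (2 * C / r) u ∧ (∀ x, |u x| ≤ 2 * C) ∧
      (∀ x, headDist d N x ≤ 3 * r → u x = 0) ∧ (∀ x, 2 * r ≤ headDist d N' x → u x = 0) ∧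
      89 * δ ≤ |intDiff (P n) (Q n) u| ∧ |intDiff (P n) (Q n) G| ≤ δ ∧
      (P n).real {x | r ≤ headDist d N' x} ≤ δ / C ∧
      (Q n).real {x | r ≤ headDist d N' x} ≤ δ / C := by
  have hBUC : ∀ f ∈ F, IsBUC f := fun f hf =>
    ControlledBy.isBUC hF le_rfl ⟨f, hf, f, hf, fun x y => by
      have := abs_nonneg (f x - f y)
      linarith⟩ (hC f hf)
  have hsmall : ∀ g, IsBUC g → ∀ᶠ n in atTop, |intDiff (P n) (Q n) g| ≤ δ := fun g hg => by
    have := (h g hg).abs.eventually (ge_mem_nhds (by simpa using hδ) : Iic δ ∈ 𝓝 |(0 : ℝ)|)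
    exact this
  obtain ⟨T, hTF, hTfin, hT⟩ := exists_finite_approx hC d N hδ
  have hev : ∀ᶠ n in atTop, (∀ g ∈ T, |intDiff (P n) (Q n) g| ≤ δ) ∧
      |intDiff (P n) (Q n) G| ≤ δ :=
    (hTfin.eventually_all.2 fun g hg => hsmall g (hBUC g (hTF hg))).and (hsmall G hG)
  obtain ⟨n₀, hn₀⟩ := eventually_atTop.1 hev
  obtain ⟨n, hn, f, hf, hfn⟩ := hbig (max m n₀)
  obtain ⟨hnT, hnG⟩ := hn₀ n ((le_max_right _ _).trans hn.le)
  obtain ⟨g, hgT, hfg⟩ := hT f hf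
  have hgF := hTF hgT
  have hη : 0 < δ / C := by positivity
  obtain ⟨N', hN', hPN, hQN⟩ := ((eventually_ge_atTop N).and
    ((eventually_measureReal_le_headDist_le (P n) hd hr hη).and
      (eventually_measureReal_le_headDist_le (Q n) hd hr hη))).exists
  have hK : 0 ≤ 2 * C / r := by positivity
  have h3δ : 0 ≤ 3 * δ := by positivity
  have hv : IsBUC fun x => f x - g x := (hBUC f hf).sub (hBUC g hgF)
  set w : H → ℝ := fun x => softThreshold (3 * δ) (f x - g x) with hw
  have hwC : ∀ x, |w x| ≤ 2 * C := fun x => by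
    have h1 := abs_softThreshold_le h3δ (f x - g x)
    have h2 := abs_sub (f x) (g x)
    have h3 := hC f hf x
    have h4 := hC g hgF x
    linarith
  have hwosc : ∀ x y, |w x - w y| ≤ |f x - f y| + |g x - g y| := fun x y => by
    have h1 := abs_softThreshold_sub_le h3δ (f x - g x) (f y - g y)
    have h2 := abs_sub (f x - f y) (g x - g y)
    rw [show f x - g x - (f y - g y) = f x - f y - (g x - g y) by ring] at h1
    exact h1.trans h2
  have hwB : IsBUC w := ControlledBy.isBUC hF le_rfl
    ⟨f, hf, g, hgF, fun x y => by simpa using hwosc x y⟩ hwC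
  have hw0 : ∀ x, headDist d N x ≤ 3 * r → w x = 0 := fun x hx => by
    obtain ⟨i, hi, hxi⟩ := exists_dist_lt_of_headDist_lt (show headDist d N x < 4 * r by linarith)
    have h1 := hosc f hf x (d i) hxi.le
    have h2 := hosc g hgF x (d i) hxi.le
    have h3 := hfg i hi
    refine softThreshold_eq_zero (abs_le.2 ?_)
    rw [abs_lt] at h1 h2 h3
    constructor <;> linarith
  set u : H → ℝ := fun x => cutoff r (headDist d N' x) * w x with hu
  have hu1 : ∀ x, headDist d N' x ≤ r → u x = w x := fun x hx => by
    simp [hu, cutoff_eq_one hr hx]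
  have huC : ∀ x, |u x| ≤ 2 * C := fun x => by
    rw [hu, abs_mul, abs_of_nonneg (cutoff_nonneg _ _)]
    exact (mul_le_of_le_one_left (abs_nonneg _) (cutoff_le_one _ _)).trans (hwC x)
  have huw : ∀ x, |w x - u x| ≤ 2 * C := fun x => by
    have h1 := cutoff_nonneg r (headDist d N' x)
    have h2 := cutoff_le_one r (headDist d N' x)
    rw [hu, show w x - cutoff r (headDist d N' x) * w x
      = (1 - cutoff r (headDist d N' x)) * w x by ring, abs_mul, abs_of_nonneg (by linarith)]
    exact (mul_le_of_le_one_left (abs_nonneg _) (by linarith)).trans (hwC x)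
  have hucon : ControlledBy F (2 * C / r) u := by
    refine ⟨f, hf, g, hgF, fun x y => ?_⟩
    have h1 := abs_cutoff_sub_le hr (headDist d N' x) (headDist d N' y)
    have h2 : |headDist d N' x - headDist d N' y| ≤ dist x y := by
      have h3 := headDist_le_add_dist d N' x y
      have h4 := headDist_le_add_dist d N' y x
      rw [dist_comm y x] at h4
      exact abs_le.2 ⟨by linarith, by linarith⟩
    have h5 : |cutoff r (headDist d N' x) - cutoff r (headDist d N' y)| ≤ dist x y / r :=
      h1.trans (by gcongr)
    have h6 : u x - u y = cutoff r (headDist d N' x) * (w x - w y) +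
        (cutoff r (headDist d N' x) - cutoff r (headDist d N' y)) * w y := by
      simp only [hu]
      ring
    rw [h6]
    refine (abs_add_le _ _).trans (add_le_add ?_ ?_)
    · rw [abs_mul, abs_of_nonneg (cutoff_nonneg _ _)]
      exact (mul_le_of_le_one_left (abs_nonneg _) (cutoff_le_one _ _)).trans (hwosc x y)
    · rw [abs_mul, show 2 * C / r * dist x y = dist x y / r * (2 * C) by ring]
      exact mul_le_mul h5 (hwC y) (abs_nonneg _) (by positivity)
  have huB : IsBUC u := hucon.isBUC hF hK huC
  refine ⟨n, (le_max_left _ _).trans_lt hn, N', hN', u, hucon, huC, fun x hx => ?_,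
    fun x hx => ?_, ?_, hnG, hPN, hQN⟩
  · simp [hu, hw0 x hx]
  · simp [hu, cutoff_eq_zero hr hx]
  have e1 : |intDiff (P n) (Q n) fun x => f x - g x - w x| ≤ 2 * (3 * δ) :=
    abs_integral_sub_integral_le _ _ fun x => abs_sub_softThreshold_le h3δ _
  have e2 : |intDiff (P n) (Q n) fun x => w x - u x| ≤ 2 * (2 * C * (δ / C)) :=
    abs_integral_sub_integral_le_of_eq_zero_off (s := {x | r ≤ headDist d N' x}) _ _
      (by positivity) huw
      (fun x hx => sub_eq_zero.2 (hu1 x (not_le.1 hx).le).symm) hPN hQN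
  rw [show 2 * (2 * C * (δ / C)) = 4 * δ by field_simp; ring, intDiff_sub _ _ hwB huB] at e2
  rw [intDiff_sub _ _ hv hwB, intDiff_sub _ _ (hBUC f hf) (hBUC g hgF)] at e1
  have e3 := hnT g hgT
  grind

section DisjointSum

variable {H : Type*} [MetricSpace H] {d : ℕ → H} {r : ℝ} {N : ℕ → ℕ} {u : ℕ → H → ℝ}

theorem eq_zero_of_ne_of_dist_lt (hN : Monotone N)
    (hin : ∀ k x, headDist d (N k) x ≤ 3 * r → u k x = 0)
    (hout : ∀ k x, 2 * r ≤ headDist d (N (k + 1)) x → u k x = 0)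
    {j k : ℕ} {x y : H} (hjk : k ≠ j) (hx : u j x ≠ 0) (hxy : dist x y < r) : u k y = 0 := by
  rcases lt_or_gt_of_ne hjk with hlt | hlt
  · have h1 : 3 * r < headDist d (N j) x := not_le.1 fun h => hx (hin j x h)
    have h2 := headDist_le_add_dist d (N j) x y
    have h3 : headDist d (N j) y ≤ headDist d (N (k + 1)) y := headDist_antitone d y (hN hlt)
    exact hout k y (by linarith)
  · have h1 : headDist d (N (j + 1)) x < 2 * r := not_le.1 fun h => hx (hout j x h)
    have h2 := headDist_le_add_dist d (N (j + 1)) y x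
    have h3 : headDist d (N k) y ≤ headDist d (N (j + 1)) y := headDist_antitone d y (hN hlt)
    rw [dist_comm] at h2
    exact hin k y (by linarith)

theorem exists_forall_ne_eq_zero (hN : Monotone N)
    (hin : ∀ k x, headDist d (N k) x ≤ 3 * r → u k x = 0)
    (hout : ∀ k x, 2 * r ≤ headDist d (N (k + 1)) x → u k x = 0) (hr : 0 < r)
    {x y : H} (hxy : dist x y < r) : ∃ j, ∀ k ≠ j, u k x = 0 ∧ u k y = 0 := by
  have hxx : dist x x < r := by simpa using hr
  have hyy : dist y y < r := by simpa using hr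
  by_cases hx : ∃ j, u j x ≠ 0
  · obtain ⟨j, hj⟩ := hx
    exact ⟨j, fun k hk => ⟨eq_zero_of_ne_of_dist_lt hN hin hout hk hj hxx,
      eq_zero_of_ne_of_dist_lt hN hin hout hk hj hxy⟩⟩
  · push Not at hx
    by_cases hy : ∃ j, u j y ≠ 0
    · obtain ⟨j, hj⟩ := hy
      exact ⟨j, fun k hk => ⟨hx k, eq_zero_of_ne_of_dist_lt hN hin hout hk hj hyy⟩⟩
    · push Not at hy
      exact ⟨0, fun k _ => ⟨hx k, hy k⟩⟩

theorem isBUC_tsum {F : Set (H → ℝ)} (hF : IsUniformEquicont F) {K B : ℝ} (hK : 0 ≤ K)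
    (hN : Monotone N)
    (hin : ∀ k x, headDist d (N k) x ≤ 3 * r → u k x = 0)
    (hout : ∀ k x, 2 * r ≤ headDist d (N (k + 1)) x → u k x = 0) (hr : 0 < r)
    (hu : ∀ k, ControlledBy F K (u k)) (hB : ∀ k x, |u k x| ≤ B) :
    IsBUC fun x => ∑' k, u k x := by
  refine ⟨Metric.uniformContinuous_iff.2 fun e he => ?_, B, fun x => ?_⟩
  · obtain ⟨t, ht, h⟩ := hF.controlledBy hK he
    refine ⟨min t r, lt_min ht hr, fun {x y} hxy => ?_⟩
    obtain ⟨j, hj⟩ :=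
      exists_forall_ne_eq_zero hN hin hout hr (hxy.trans_le (min_le_right _ _))
    rw [tsum_eq_single j fun k hk => (hj k hk).1, tsum_eq_single j fun k hk => (hj k hk).2]
    exact h (u j) (hu j) x y (hxy.trans_le (min_le_left _ _))
  · obtain ⟨j, hj⟩ :=
      exists_forall_ne_eq_zero hN hin hout hr (show dist x x < r by simpa using hr)
    beta_reduce
    rw [tsum_eq_single j fun k hk => (hj k hk).1]
    exact hB j x

theorem abs_tsum_sub_sum_range_le {B : ℝ} (hN : Monotone N)
    (hin : ∀ k x, headDist d (N k) x ≤ 3 * r → u k x = 0)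
    (hout : ∀ k x, 2 * r ≤ headDist d (N (k + 1)) x → u k x = 0) (hr : 0 < r)
    (hB : ∀ k x, |u k x| ≤ B) (k : ℕ) (x : H) :
    |(∑' i, u i x) - ∑ i ∈ Finset.range k, u i x| ≤ B := by
  obtain ⟨j, hj⟩ :=
    exists_forall_ne_eq_zero hN hin hout hr (show dist x x < r by simpa using hr)
  rw [tsum_eq_single j fun k hk => (hj k hk).1]
  by_cases hjk : j ∈ Finset.range k
  · rw [Finset.sum_eq_single_of_mem j hjk fun i _ hi => (hj i hi).1, sub_self, abs_zero]
    exact (abs_nonneg _).trans (hB j x)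
  · rw [Finset.sum_eq_zero fun i hi => (hj i fun hij => hjk (hij ▸ hi)).1, sub_zero]
    exact hB j x

theorem tsum_eq_sum_range_of_headDist_le (hN : Monotone N)
    (hin : ∀ k x, headDist d (N k) x ≤ 3 * r → u k x = 0) {k : ℕ} {x : H}
    (hx : headDist d (N k) x ≤ 3 * r) : ∑' i, u i x = ∑ i ∈ Finset.range k, u i x := by
  refine tsum_eq_sum fun i hi => hin i x ?_
  have hki : k ≤ i := by simpa using hi
  exact (headDist_antitone d x (hN hki)).trans hx

end DisjointSum

/-- A uniformly bounded, uniformly equicontinuous class cannot carry infinitely many large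
integrals against `P n - Q n`. -/
theorem not_forall_exists_le_abs_intDiff {H : Type*} [MetricSpace H]
    [TopologicalSpace.SeparableSpace H] [MeasurableSpace H] [BorelSpace H]
    (P Q : ℕ → Measure H)
    [∀ n, IsProbabilityMeasure (P n)] [∀ n, IsProbabilityMeasure (Q n)]
    (h : ∀ f : H → ℝ, IsBUC f → Tendsto (fun n => intDiff (P n) (Q n) f) atTop (𝓝 0))
    {F : Set (H → ℝ)} {C : ℝ} (hC0 : 0 < C) (hC : ∀ f ∈ F, ∀ x, |f x| ≤ C)
    (hF : IsUniformEquicont F) {δ : ℝ} (hδ : 0 < δ) :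
    ¬ ∀ m, ∃ n > m, ∃ f ∈ F, 100 * δ ≤ |intDiff (P n) (Q n) f| := by
  intro hbig
  have : Nonempty H := nonempty_of_isProbabilityMeasure (P 0)
  set d := TopologicalSpace.denseSeq H
  have hd : DenseRange d := TopologicalSpace.denseRange_denseSeq H
  obtain ⟨t, ht, hosc⟩ := hF δ hδ
  obtain ⟨r, hr, rfl⟩ : ∃ r > 0, t = 4 * r := ⟨t / 4, by positivity, by ring⟩
  have hK : 0 ≤ 2 * C / r := by positivity
  have hstep : ∀ s : ℕ × ℕ × {G : H → ℝ // IsBUC G}, _ := fun s =>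
    exists_hump P Q h hC0 hC hF hd hr hδ hosc hbig s.1 s.2.1 s.2.2.2
  choose n hn N hN u hu huC hin hout hlarge hsmall hPN hQN using hstep
  let next (s : ℕ × ℕ × {G : H → ℝ // IsBUC G}) : ℕ × ℕ × {G : H → ℝ // IsBUC G} :=
    (N s, n s, ⟨fun x => s.2.2.1 x + u s x, s.2.2.2.add ((hu s).isBUC hF hK (huC s))⟩)
  let S (k : ℕ) : ℕ × ℕ × {G : H → ℝ // IsBUC G} :=
    next^[k] (0, 0, ⟨fun _ => 0, uniformContinuous_const, 0, by simp⟩)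
  have hS : ∀ k, S (k + 1) = next (S k) := fun k => Function.iterate_succ_apply' _ _ _
  have hS1 : ∀ k, (S (k + 1)).1 = N (S k) := fun k => by rw [hS]
  have hmono : Monotone fun k => (S k).1 := monotone_nat_of_le_succ fun k => by
    rw [hS1]
    exact hN (S k)
  have hnmono : StrictMono fun k => (S k).2.1 := strictMono_nat_of_lt_succ fun k => by
    rw [hS]
    exact hn (S k)
  have hsum : ∀ k x, (S k).2.2.1 x = ∑ i ∈ Finset.range k, u (S i) x := fun k x => by
    induction k with
    | zero => rfl
    | succ k ih => rw [Finset.sum_range_succ, ← ih, hS]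
  have hin' : ∀ k x, headDist d (S k).1 x ≤ 3 * r → u (S k) x = 0 := fun k => hin (S k)
  have hout' : ∀ k x, 2 * r ≤ headDist d (S (k + 1)).1 x → u (S k) x = 0 := fun k => by
    rw [hS1]
    exact hout (S k)
  have huC' : ∀ k x, |u (S k) x| ≤ 2 * C := fun k => huC (S k)
  set f : H → ℝ := fun x => ∑' k, u (S k) x
  have hf : IsBUC f :=
    isBUC_tsum (N := fun k => (S k).1) hF hK hmono hin' hout' hr (fun k => hu (S k)) huC'
  have hlow : ∀ k, δ ≤ |intDiff (P (n (S k))) (Q (n (S k))) f| := fun k => by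
    have e1 : |intDiff (P (n (S k))) (Q (n (S k))) fun x => f x - (S (k + 1)).2.2.1 x| ≤
        2 * (2 * C * (δ / C)) := by
      refine abs_integral_sub_integral_le_of_eq_zero_off
        (s := {x | r ≤ headDist d (N (S k)) x}) _ _ (by positivity) (fun x => ?_)
        (fun x hx => ?_) (hPN (S k)) (hQN (S k))
      · rw [hsum]
        exact abs_tsum_sub_sum_range_le (N := fun k => (S k).1) hmono hin' hout' hr huC' _ x
      · rw [hsum, sub_eq_zero]
        refine tsum_eq_sum_range_of_headDist_le (N := fun k => (S k).1) hmono hin' ?_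
        rw [mem_ofPred_eq, not_le] at hx
        simp only [hS1]
        linarith
    have e2 : intDiff (P (n (S k))) (Q (n (S k))) (fun x => (S (k + 1)).2.2.1 x - u (S k) x) =
        intDiff (P (n (S k))) (Q (n (S k))) (S k).2.2.1 := by
      congr 1
      ext x
      rw [hS]
      simp [next]
    rw [intDiff_sub _ _ (S (k + 1)).2.2.2 ((hu (S k)).isBUC hF hK (huC (S k)))] at e2
    rw [intDiff_sub _ _ hf (S (k + 1)).2.2.2,
      show 2 * (2 * C * (δ / C)) = 4 * δ by field_simp; ring] at e1
    have e3 := hlarge (S k)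
    have e4 := hsmall (S k)
    grind
  have hlim : Tendsto (fun k => n (S k)) atTop atTop := by
    have h1 := (hnmono.tendsto_atTop).comp (tendsto_add_atTop_nat 1)
    refine h1.congr fun k => ?_
    simp only [Function.comp, hS, next]
  have h0 := ((h f hf).comp hlim).abs
  rw [abs_zero] at h0
  exact absurd (ge_of_tendsto' h0 hlow) (not_le.2 hδ)

/-- **Corollary 2.** If `∫ f d(Pₙ − Qₙ) → 0` for every bounded uniformly
continuous `f : H → ℝ`, then `sup_{f ∈ F} |∫ f d(Pₙ − Qₙ)| → 0` for any uniformly bounded,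
uniformly equicontinuous class `F` (i.e. `ω_F(h) := sup_{f ∈ F} ω_f(h) → 0` as `h → 0`). -/
theorem uniform_convergence_on_equicontinuous_class
    {H : Type*} [MetricSpace H] [CompleteSpace H] [TopologicalSpace.SeparableSpace H]
    [MeasurableSpace H] [BorelSpace H]
    (P Q : ℕ → Measure H)
    [∀ n, IsProbabilityMeasure (P n)] [∀ n, IsProbabilityMeasure (Q n)]
    (h : ∀ f : H → ℝ, UniformContinuous f → (∃ C : ℝ, ∀ x, |f x| ≤ C) →
      Tendsto (fun n => (∫ x, f x ∂(P n)) - ∫ x, f x ∂(Q n)) atTop (𝓝 0))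
    (F : Set (H → ℝ))
    (hbdd : ∃ C : ℝ, ∀ f ∈ F, ∀ x, |f x| ≤ C)
    (hequi : Tendsto (fun t => sSup ((fun f : H → ℝ => modCont f t) '' F))
      (𝓝[≥] 0) (𝓝 0)) :
    Tendsto (fun n => sSup ((fun f : H → ℝ =>
        |(∫ x, f x ∂(P n)) - ∫ x, f x ∂(Q n)|) '' F)) atTop (𝓝 0) := by
  obtain ⟨C, hC⟩ := hbdd
  have hC' : ∀ f ∈ F, ∀ x, |f x| ≤ |C| + 1 := fun f hf x =>
    (hC f hf x).trans ((le_abs_self C).trans (by linarith))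
  have hF : IsUniformEquicont F := fun e he =>
    exists_forall_abs_sub_lt_of_tendsto_sSup_modCont hC hequi he
  by_contra hcon
  rw [Metric.tendsto_atTop] at hcon
  push Not at hcon
  obtain ⟨ε, hε, hcon⟩ := hcon
  refine not_forall_exists_le_abs_intDiff P Q (fun f hf => h f hf.1 hf.2)
    (by positivity : 0 < |C| + 1) hC' hF (δ := ε / 200) (by positivity) fun m => ?_
  obtain ⟨n, hn, hle⟩ := hcon (m + 1)
  refine ⟨n, hn, ?_⟩
  by_contra! hlt
  rw [Real.dist_eq, sub_zero, abs_of_nonneg (Real.sSup_nonneg (by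
    rintro _ ⟨f, -, rfl⟩
    exact abs_nonneg _))] at hle
  have hsup : sSup ((fun f : H → ℝ =>
      |(∫ x, f x ∂(P n)) - ∫ x, f x ∂(Q n)|) '' F) ≤ ε / 2 := by
    refine Real.sSup_le ?_ (by positivity)
    rintro _ ⟨f, hf, rfl⟩
    have := hlt f hf
    unfold intDiff at this
    linarith
  linarith
end

section
/- Let (H, ρ) be a metric space, let f : H → ℝ be a bounded uniformly continuous function, let K ⊆ H be a nonempty closed set, and let t > 0. Define f_K^{(t)}(x) = f(x) for x ∈ K, f_K^{(t)}(x) = f(x)(1 − ρ(x,K)/t) for x ∈ K^t \ K, and f_K^{(t)}(x) = 0 otherwise, where ρ(x,K) = inf_{z∈K} ρ(x,z) and K^t is the t-neighborhood of K. Then ‖f_K^{(t)}‖_∞ ≤ ‖f‖_∞, and for every h ≥ 0, ω_{f_K^{(t)}}(h) ≤ ω_f(h) + ‖f‖_∞ · h/t. -/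
open MeasureTheory Filter Topology Metric Set
open scoped Classical

/-- The sup-norm `‖f‖_∞ = sup_x |f x|` of `f : H → ℝ`. -/
noncomputable def supNorm {H : Type*} (f : H → ℝ) : ℝ :=
  sSup (Set.range fun x => |f x|)

/-- The truncation `f_K^{(t)}`: equal to `f` on `K`, equal to `f(x)(1 − ρ(x,K)/t)` on the
`t`-neighborhood `K^t \ K`, and `0` elsewhere. -/
noncomputable def truncation {H : Type*} [MetricSpace H]
    (f : H → ℝ) (K : Set H) (t : ℝ) (x : H) : ℝ :=
  if x ∈ K then f x
  else if x ∈ Metric.thickening t K \ K then f x * (1 - Metric.infDist x K / t)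
  else 0

/-- On a nonempty closed set, the truncation is `f` times the tent `max 0 (1 - ρ(x,K)/t)`. -/
theorem truncation_eq_mul {H : Type*} [MetricSpace H] (f : H → ℝ) {K : Set H}
    (hK_closed : IsClosed K) (hK_ne : K.Nonempty) {t : ℝ} (ht : 0 < t) (x : H) :
    truncation f K t x = f x * max 0 (1 - infDist x K / t) := by
  unfold truncation
  split_ifs with hx hxt
  · simp [(hK_closed.mem_iff_infDist_zero hK_ne).1 hx]
  · have hlt := (mem_thickening_iff_infDist_lt hK_ne).1 hxt.1
    rw [max_eq_right (sub_nonneg.2 ((div_le_one ht).2 hlt.le))]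
  · have hle : t ≤ infDist x K := by
      by_contra! hlt
      exact hxt ⟨(mem_thickening_iff_infDist_lt hK_ne).2 hlt, hx⟩
    rw [max_eq_left (sub_nonpos.2 ((one_le_div ht).2 hle)), mul_zero]

theorem abs_tent_sub_le {H : Type*} [MetricSpace H] (K : Set H) {t : ℝ} (ht : 0 < t) (x y : H) :
    |max 0 (1 - infDist x K / t) - max 0 (1 - infDist y K / t)| ≤ dist x y / t := by
  calc _ ≤ |(1 - infDist x K / t) - (1 - infDist y K / t)| := by
        simpa only [max_comm] using
          abs_max_sub_max_le_abs (1 - infDist x K / t) (1 - infDist y K / t) 0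
    _ = |infDist x K - infDist y K| / t := by
        rw [sub_sub_sub_cancel_left, ← sub_div, abs_div, abs_of_pos ht, abs_sub_comm]
    _ ≤ dist x y / t := by
        gcongr
        simpa [Real.dist_eq] using (lipschitz_infDist_pt K).dist_le_mul x y

theorem abs_le_supNorm {H : Type*} {f : H → ℝ} (hf : ∃ C : ℝ, ∀ x, |f x| ≤ C) (x : H) :
    |f x| ≤ supNorm f := by
  obtain ⟨C, hC⟩ := hf
  exact le_csSup ⟨C, by rintro _ ⟨y, rfl⟩; exact hC y⟩ ⟨x, rfl⟩

theorem abs_sub_le_modCont {H : Type*} [MetricSpace H] {f : H → ℝ}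
    (hf : ∃ C : ℝ, ∀ x, |f x| ≤ C) {h : ℝ} {x y : H} (hxy : dist x y ≤ h) :
    |f x - f y| ≤ modCont f h := by
  obtain ⟨C, hC⟩ := hf
  refine le_csSup ⟨C + C, ?_⟩ ⟨x, y, hxy, rfl⟩
  rintro _ ⟨a, b, -, rfl⟩
  exact (abs_sub (f a) (f b)).trans (add_le_add (hC a) (hC b))

/-- **Lemma 4.** For a bounded uniformly continuous `f`, a nonempty closed
`K` and `t > 0`: `‖f_K^{(t)}‖_∞ ≤ ‖f‖_∞`, and for every `h ≥ 0`,
`ω_{f_K^{(t)}}(h) ≤ ω_f(h) + ‖f‖_∞ · h / t`. -/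
theorem truncation_supNorm_le_and_modCont_le
    {H : Type*} [MetricSpace H] (f : H → ℝ)
    (hf_uc : UniformContinuous f) (hf_bdd : ∃ C : ℝ, ∀ x, |f x| ≤ C)
    (K : Set H) (hK_closed : IsClosed K) (hK_ne : K.Nonempty)
    (t : ℝ) (ht : 0 < t) :
    supNorm (truncation f K t) ≤ supNorm f ∧
    ∀ h : ℝ, 0 ≤ h →
      modCont (truncation f K t) h ≤ modCont f h + supNorm f * (h / t) := by
  obtain ⟨x₀, -⟩ := id hK_ne
  have tent_nonneg (x : H) : 0 ≤ max 0 (1 - infDist x K / t) := le_max_left _ _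
  have tent_le_one (x : H) : max 0 (1 - infDist x K / t) ≤ 1 :=
    max_le zero_le_one (sub_le_self _ (div_nonneg infDist_nonneg ht.le))
  constructor
  · refine csSup_le ⟨_, x₀, rfl⟩ ?_
    rintro _ ⟨x, rfl⟩
    change |truncation f K t x| ≤ supNorm f
    rw [truncation_eq_mul f hK_closed hK_ne ht, abs_mul, abs_of_nonneg (tent_nonneg x)]
    exact (mul_le_of_le_one_right (abs_nonneg _) (tent_le_one x)).trans (abs_le_supNorm hf_bdd x)
  · intro h hh
    refine csSup_le ⟨_, x₀, x₀, by simpa using hh, rfl⟩ ?_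
    rintro _ ⟨x, y, hxy, rfl⟩
    rw [truncation_eq_mul f hK_closed hK_ne ht, truncation_eq_mul f hK_closed hK_ne ht]
    have htent := abs_tent_sub_le K ht x y
    have hx₁ := tent_le_one x
    have hx₀ := tent_nonneg x
    generalize max 0 (1 - infDist x K / t) = a at *
    generalize max 0 (1 - infDist y K / t) = b at *
    calc |f x * a - f y * b| = |(f x - f y) * a + f y * (a - b)| := by ring_nf
      _ ≤ |f x - f y| * a + |f y| * |a - b| := by
          simpa only [abs_mul, abs_of_nonneg hx₀] using
            abs_add_le ((f x - f y) * a) (f y * (a - b))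
      _ ≤ modCont f h + supNorm f * (h / t) := by
          refine add_le_add ?_ ?_
          · exact (mul_le_of_le_one_right (abs_nonneg _) hx₁).trans
              (abs_sub_le_modCont hf_bdd hxy)
          · exact mul_le_mul (abs_le_supNorm hf_bdd y)
              (htent.trans (div_le_div_of_nonneg_right hxy ht.le)) (abs_nonneg _)
              ((abs_nonneg _).trans (abs_le_supNorm hf_bdd y))
end

section
/- Let (H, ρ) be a complete separable metric space and let {P_n}, {Q_n} be sequences of Borel probability measures on H such that ∫ f dP_n − ∫ f dQ_n → 0 for every bounded uniformly continuous function f : H → ℝ. Let F be a class of functions f : H → ℝ that is uniformly bounded and uniformly equicontinuous, and set ω(h) := sup_{f∈F} ω_f(h). Then for any nonempty compact set K ⊆ H and any t > 0, limsup_n sup_{f ∈ F} |∫ f_K^{(t)} dP_n − ∫ f_K^{(t)} dQ_n| ≤ 4ω(t), where f_K^{(t)}(x) = f(x) for x ∈ K, f_K^{(t)}(x) = f(x)(1 − ρ(x,K)/t) for x ∈ K^t \ K, and f_K^{(t)}(x) = 0 otherwise. -/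
open MeasureTheory Filter Topology Metric Set
open scoped Classical

lemma two_mul_mem_upperBounds_abs_sub {H : Type*} [MetricSpace H] {f : H → ℝ} {C : ℝ} (hf : ∀ x, |f x| ≤ C)
    (s : ℝ) : 2 * C ∈ upperBounds {d : ℝ | ∃ x y : H, dist x y ≤ s ∧ d = |f x - f y|} := by
  rintro d ⟨x, y, -, rfl⟩
  have := abs_sub (f x) (f y)
  linarith [hf x, hf y]

/-- Increments of a member of a uniformly bounded class are controlled by the class modulus. -/
lemma abs_sub_le_sSup_modCont {H : Type*} [MetricSpace H] {F : Set (H → ℝ)} {C : ℝ}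
    (hF : ∀ f ∈ F, ∀ x, |f x| ≤ C) {f : H → ℝ} (hf : f ∈ F) {s : ℝ} {x y : H}
    (hxy : dist x y ≤ s) :
    |f x - f y| ≤ sSup ((fun f : H → ℝ => modCont f s) '' F) := by
  have h1 : |f x - f y| ≤ modCont f s :=
    le_csSup ⟨_, two_mul_mem_upperBounds_abs_sub (hF f hf) s⟩ ⟨x, y, hxy, rfl⟩
  refine h1.trans (le_csSup ⟨2 * C, ?_⟩ ⟨f, hf, rfl⟩)
  rintro _ ⟨g, hg, rfl⟩
  exact csSup_le ⟨_, x, y, hxy, rfl⟩ (two_mul_mem_upperBounds_abs_sub (hF g hg) s)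

lemma truncation_eq_mul_max {H : Type*} [MetricSpace H] (f : H → ℝ) {K : Set H}
    (hK : K.Nonempty) {t : ℝ} (ht : 0 < t) (x : H) :
    truncation f K t x = f x * max 0 (1 - infDist x K / t) := by
  unfold truncation
  split_ifs with h1 h2
  · simp [infDist_zero_of_mem h1]
  · have h3 : infDist x K < t := by
      obtain ⟨z, hz, hxz⟩ := mem_thickening_iff.1 h2.1
      exact (infDist_le_dist_of_mem hz).trans_lt hxz
    rw [max_eq_right]
    have := (div_lt_one ht).2 h3
    linarith
  · have h3 : t ≤ infDist x K := by
      by_contra! hlt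
      obtain ⟨z, hz, hxz⟩ := (infDist_lt_iff hK).1 hlt
      exact h2 ⟨mem_thickening_iff.2 ⟨z, hz, hxz⟩, h1⟩
    rw [max_eq_left, mul_zero]
    have := (one_le_div ht).2 h3
    linarith

lemma max_one_sub_infDist_mem_Icc {H : Type*} [MetricSpace H] (K : Set H) {t : ℝ} (ht : 0 < t)
    (x : H) : max 0 (1 - infDist x K / t) ∈ Icc (0 : ℝ) 1 := by
  have := div_nonneg (infDist_nonneg (x := x) (s := K)) ht.le
  exact ⟨le_max_left _ _, max_le zero_le_one (by linarith)⟩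

lemma abs_truncation_le {H : Type*} [MetricSpace H] {f : H → ℝ} {C : ℝ} (hf : ∀ x, |f x| ≤ C)
    {K : Set H} (hK : K.Nonempty) {t : ℝ} (ht : 0 < t) (x : H) : |truncation f K t x| ≤ C := by
  obtain ⟨h0, h1⟩ := max_one_sub_infDist_mem_Icc K ht x
  rw [truncation_eq_mul_max f hK ht, abs_mul, abs_of_nonneg h0]
  exact (mul_le_of_le_one_right (abs_nonneg _) h1).trans (hf x)

lemma uniformContinuous_truncation {H : Type*} [MetricSpace H] {f : H → ℝ} {C : ℝ}
    (hf : ∀ x, |f x| ≤ C) (hfc : UniformContinuous f)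
    {K : Set H} (hK : K.Nonempty) {t : ℝ} (ht : 0 < t) :
    UniformContinuous (truncation f K t) := by
  have hg : UniformContinuous fun x => max 0 (1 - infDist x K / t) := by
    have h1 : UniformContinuous fun x => 1 - infDist x K / t := by
      simp_rw [div_eq_inv_mul]
      exact uniformContinuous_const.sub ((uniformContinuous_infDist_pt K).const_mul' t⁻¹)
    exact ((LipschitzWith.id.const_max 0).uniformContinuous).comp h1
  rw [funext (truncation_eq_mul_max f hK ht)]
  rw [Metric.uniformContinuous_iff] at hfc hg ⊢
  intro ε hε
  have hC : 0 ≤ C := (abs_nonneg _).trans (hf hK.some)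
  obtain ⟨a, ha, hfa⟩ := hfc (ε / 2) (by positivity)
  obtain ⟨b, hb, hgb⟩ := hg (ε / (2 * (C + 1))) (by positivity)
  refine ⟨min a b, lt_min ha hb, fun x y hxy => ?_⟩
  have h1 := hfa (hxy.trans_le (min_le_left _ _))
  have h2 := hgb (hxy.trans_le (min_le_right _ _))
  obtain ⟨hx0, hx1⟩ := max_one_sub_infDist_mem_Icc K ht x
  rw [Real.dist_eq] at h1 h2 ⊢
  generalize max 0 (1 - infDist x K / t) = u at *
  generalize max 0 (1 - infDist y K / t) = v at *
  have e : f x * u - f y * v = (f x - f y) * u + f y * (u - v) := by ring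
  rw [e]
  refine (abs_add_le _ _).trans_lt ?_
  rw [abs_mul, abs_mul, abs_of_nonneg hx0]
  have h3 : |f x - f y| * u ≤ |f x - f y| := mul_le_of_le_one_right (abs_nonneg _) hx1
  have h4 : |f y| * |u - v| ≤ (C + 1) * (ε / (2 * (C + 1))) :=
    mul_le_mul (by linarith [hf y]) h2.le (abs_nonneg _) (by positivity)
  have h5 : (C + 1) * (ε / (2 * (C + 1))) = ε / 2 := by field_simp
  linarith

/-- Two functions that are `ε`-close on `K` and have increments at most `w` at scale `t` have
truncations that are `(2 w + ε)`-close everywhere. -/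
lemma abs_truncation_sub_le {H : Type*} [MetricSpace H] {f g : H → ℝ} {K : Set H}
    (hK : K.Nonempty) {t w ε : ℝ} (ht : 0 < t)
    (hf : ∀ x y, dist x y ≤ t → |f x - f y| ≤ w) (hg : ∀ x y, dist x y ≤ t → |g x - g y| ≤ w)
    (hfg : ∀ z ∈ K, |f z - g z| ≤ ε) (x : H) :
    |truncation f K t x - truncation g K t x| ≤ 2 * w + ε := by
  rw [truncation_eq_mul_max f hK ht, truncation_eq_mul_max g hK ht, ← sub_mul, abs_mul]
  obtain ⟨h0, h1⟩ := max_one_sub_infDist_mem_Icc K ht x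
  rw [abs_of_nonneg h0]
  rcases lt_or_ge (infDist x K) t with hlt | hge
  · obtain ⟨z, hz, hxz⟩ := (infDist_lt_iff hK).1 hlt
    refine (mul_le_of_le_one_right (abs_nonneg _) h1).trans ?_
    have e : f x - g x = (f x - f z) - (g x - g z) + (f z - g z) := by ring
    rw [e]
    have h2 := abs_add_le ((f x - f z) - (g x - g z)) (f z - g z)
    have h3 := abs_sub (f x - f z) (g x - g z)
    linarith [hf x z hxz.le, hg x z hxz.le, hfg z hz]
  · have h2 := (one_le_div ht).2 hge
    rw [max_eq_left (by linarith), mul_zero]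
    obtain ⟨z, hz⟩ := hK
    have h3 := (abs_nonneg _).trans (hf z z (by simpa using ht.le))
    have h4 := (abs_nonneg _).trans (hfg z hz)
    linarith

/-- A uniformly bounded, uniformly equicontinuous class has finite `ε`-nets for uniform
convergence on a totally bounded set. -/
lemma exists_finite_net_on {H : Type*} [MetricSpace H] {F : Set (H → ℝ)} {C : ℝ}
    (hF : ∀ f ∈ F, ∀ x, |f x| ≤ C)
    (hequi : ∀ ε > 0, ∃ δ > 0, ∀ f ∈ F, ∀ x y, dist x y ≤ δ → |f x - f y| ≤ ε)
    {K : Set H} (hK : TotallyBounded K) {ε : ℝ} (hε : 0 < ε) :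
    ∃ G ⊆ F, G.Finite ∧ ∀ f ∈ F, ∃ g ∈ G, ∀ z ∈ K, |f z - g z| ≤ ε := by
  obtain ⟨δ, hδ, hδF⟩ := hequi (ε / 3) (by positivity)
  obtain ⟨S, -, hS, hKS⟩ := finite_approx_of_totallyBounded hK δ hδ
  have : Fintype S := hS.fintype
  have htb : TotallyBounded ((fun (f : H → ℝ) (z : S) => f z) '' F) := by
    refine (isCompact_univ_pi fun _ : S =>
      isCompact_Icc (a := -C) (b := C)).totallyBounded.subset ?_
    rintro _ ⟨f, hf, rfl⟩ z -
    exact abs_le.1 (hF f hf z)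
  obtain ⟨T, hTF, hT, hcov⟩ := finite_approx_of_totallyBounded htb (ε / 3) (by positivity)
  obtain ⟨G, hGF, hG, rfl⟩ := (exists_subset_image_finite_and
    (p := fun s => s = T)).1 ⟨T, hTF, hT, rfl⟩
  refine ⟨G, hGF, hG, fun f hf => ?_⟩
  obtain ⟨_, ⟨g, hg, rfl⟩, hfg⟩ := mem_iUnion₂.1 (hcov ⟨f, hf, rfl⟩)
  refine ⟨g, hg, fun z hz => ?_⟩
  obtain ⟨y, hy, hzy⟩ := mem_iUnion₂.1 (hKS hz)
  have h1 : |f y - g y| ≤ ε / 3 := by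
    have := (dist_le_pi_dist (fun z : S => f z) (fun z : S => g z) ⟨y, hy⟩).trans
      (mem_ball.1 hfg).le
    simpa [Real.dist_eq] using this
  have h2 := hδF f hf z y (mem_ball.1 hzy).le
  have h3 := hδF g (hGF hg) z y (mem_ball.1 hzy).le
  rw [abs_le] at *
  constructor <;> linarith

/-- **Lemma 5.** Suppose `∫ f dPₙ − ∫ f dQₙ → 0` for every bounded
uniformly continuous `f : H → ℝ`, and let `F` be a uniformly bounded, uniformly
equicontinuous class with `ω(h) := sup_{f ∈ F} ω_f(h)`. Then for every nonempty compact
`K ⊆ H` and every `t > 0`,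
`limsupₙ sup_{f ∈ F} |∫ f_K^{(t)} dPₙ − ∫ f_K^{(t)} dQₙ| ≤ 4 ω(t)`. -/
theorem limsup_truncation_le_of_weak_uc_convergence
    {H : Type*} [MetricSpace H] [CompleteSpace H] [TopologicalSpace.SeparableSpace H]
    [MeasurableSpace H] [BorelSpace H]
    (P Q : ℕ → Measure H)
    [∀ n, IsProbabilityMeasure (P n)] [∀ n, IsProbabilityMeasure (Q n)]
    (h : ∀ f : H → ℝ, UniformContinuous f → (∃ C : ℝ, ∀ x, |f x| ≤ C) →
      Tendsto (fun n => (∫ x, f x ∂(P n)) - ∫ x, f x ∂(Q n)) atTop (𝓝 0))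
    (F : Set (H → ℝ))
    (hbdd : ∃ C : ℝ, ∀ f ∈ F, ∀ x, |f x| ≤ C)
    (hequi : Tendsto (fun s => sSup ((fun f : H → ℝ => modCont f s) '' F))
      (𝓝[≥] 0) (𝓝 0))
    (K : Set H) (hK : IsCompact K) (hK_ne : K.Nonempty)
    (t : ℝ) (ht : 0 < t) :
    Filter.limsup (fun n => sSup ((fun f : H → ℝ =>
        |(∫ x, truncation f K t x ∂(P n)) - ∫ x, truncation f K t x ∂(Q n)|) '' F))
      atTop ≤ 4 * sSup ((fun f : H → ℝ => modCont f t) '' F) := by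
  obtain ⟨C, hC⟩ := hbdd
  have hω : ∀ f ∈ F, ∀ s x y, dist x y ≤ s →
      |f x - f y| ≤ sSup ((fun f : H → ℝ => modCont f s) '' F) :=
    fun f hf s x y hxy => abs_sub_le_sSup_modCont hC hf hxy
  have hequi' : ∀ ε > 0, ∃ δ > 0, ∀ f ∈ F, ∀ x y, dist x y ≤ δ → |f x - f y| ≤ ε := by
    intro ε hε
    have h1 := (hequi.mono_left (nhdsWithin_mono 0 Ioi_subset_Ici_self)).eventually_le_const hε
    obtain ⟨δ, hδ, hδ0⟩ := (h1.and self_mem_nhdsWithin).exists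
    exact ⟨δ, hδ0, fun f hf x y hxy => (hω f hf δ x y hxy).trans hδ⟩
  have huc : ∀ f ∈ F, UniformContinuous (truncation f K t) := by
    intro f hf
    refine uniformContinuous_truncation (hC f hf) (Metric.uniformContinuous_iff.2 ?_) hK_ne ht
    intro ε hε
    obtain ⟨δ, hδ, hδF⟩ := hequi' (ε / 2) (by positivity)
    exact ⟨δ, hδ, fun x y hxy => (hδF f hf x y hxy.le).trans_lt (by linarith)⟩
  have hint : ∀ f ∈ F, ∀ (μ : Measure H) [IsProbabilityMeasure μ],
      Integrable (truncation f K t) μ := fun f hf μ _ =>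
    Integrable.of_bound (huc f hf).continuous.aestronglyMeasurable C
      (ae_of_all _ fun x => abs_truncation_le (hC f hf) hK_ne ht x)
  set w := sSup ((fun f : H → ℝ => modCont f t) '' F) with hw
  refine le_of_forall_pos_le_add fun ε hε => ?_
  obtain ⟨G, hGF, hG, hnet⟩ := exists_finite_net_on hC hequi' hK.totallyBounded
    (show 0 < ε / 3 by positivity)
  have hev : ∀ᶠ n in atTop, ∀ g ∈ G,
      |(∫ x, truncation g K t x ∂(P n)) - ∫ x, truncation g K t x ∂(Q n)| ≤ ε / 3 := by
    refine (Filter.eventually_all_finite hG).2 fun g hg => ?_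
    have h1 := (h _ (huc g (hGF hg)) ⟨C, abs_truncation_le (hC g (hGF hg)) hK_ne ht⟩).abs
    rw [abs_zero] at h1
    exact h1.eventually_le_const (by positivity)
  refine limsup_le_of_le ?_ ?_
  · refine IsCoboundedUnder.of_frequently_ge (a := 0) (Eventually.frequently (.of_forall fun n => ?_))
    refine Real.sSup_nonneg ?_
    rintro _ ⟨f, -, rfl⟩
    exact abs_nonneg _
  filter_upwards [hev] with n hn
  have hw0 : 0 ≤ w := by
    refine Real.sSup_nonneg ?_
    rintro _ ⟨f, -, rfl⟩
    refine Real.sSup_nonneg ?_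
    rintro _ ⟨x, y, -, rfl⟩
    exact abs_nonneg _
  refine Real.sSup_le ?_ (by positivity)
  rintro _ ⟨f, hf, rfl⟩
  obtain ⟨g, hg, hfg⟩ := hnet f hf
  have hclose : ∀ (μ : Measure H) [IsProbabilityMeasure μ],
      |(∫ x, truncation f K t x ∂μ) - ∫ x, truncation g K t x ∂μ| ≤ 2 * w + ε / 3 := by
    intro μ _
    rw [← integral_sub (hint f hf μ) (hint g (hGF hg) μ)]
    have := norm_integral_le_of_norm_le_const (μ := μ)
      (f := fun x => truncation f K t x - truncation g K t x) (ae_of_all _ fun x =>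
      abs_truncation_sub_le hK_ne ht (fun x y hxy => hω f hf t x y hxy)
        (fun x y hxy => hω g (hGF hg) t x y hxy) hfg x)
    simpa [hw] using this
  have h1 := abs_le.1 (hclose (P n))
  have h2 := abs_le.1 (hclose (Q n))
  have h3 := abs_le.1 (hn g hg)
  exact abs_le.2 ⟨by linarith, by linarith⟩
end

section
/- Let (H, ρ) be a complete separable metric space and let {P_n}, {Q_n} be sequences of Borel probability measures on H. Suppose ∫ f dP_n − ∫ f dQ_n → 0 for every bounded uniformly continuous function f : H → ℝ, and suppose the sequence {Q_n} is tight (for every ε > 0 there is a compact set K with Q_n(K) ≥ 1 − ε for all n). Then the sequence {P_n} is tight. -/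
open MeasureTheory Filter Topology Metric Set

theorem isCompact_iInter_cthickening {X : Type*} [MetricSpace X] [CompleteSpace X]
    {K : ℕ → Set X} (hK : ∀ m, IsCompact (K m)) {δ : ℕ → ℝ} (hδ : Tendsto δ atTop (𝓝 0)) :
    IsCompact (⋂ m, cthickening (δ m) (K m)) := by
  refine isCompact_iff_totallyBounded_isComplete.2
    ⟨?_, (isClosed_iInter fun m => isClosed_cthickening).isComplete⟩
  rw [Metric.totallyBounded_iff]
  intro r hr
  obtain ⟨m, hm⟩ := (hδ.eventually (gt_mem_nhds (half_pos hr))).exists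
  obtain ⟨t, ht, hcover⟩ := Metric.totallyBounded_iff.1 (hK m).totallyBounded (r / 2) (half_pos hr)
  refine ⟨t, ht, fun x hx => ?_⟩
  obtain ⟨z, hz, hxz⟩ := mem_thickening_iff.1
    (cthickening_subset_thickening' (half_pos hr) hm (K m) (mem_iInter.1 hx m))
  obtain ⟨y, hy, hzy⟩ := mem_iUnion₂.1 (hcover hz)
  refine mem_iUnion₂.2 ⟨y, hy, ?_⟩
  rw [mem_ball] at hzy ⊢
  linarith [dist_triangle x z y]

theorem isTightMeasureSet_of_forall_cthickening {X : Type*} [MetricSpace X] [CompleteSpace X]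
    [MeasurableSpace X] {S : Set (Measure X)}
    (hS : ∀ δ : ℝ, 0 < δ → ∀ η : ENNReal, 0 < η →
      ∃ K : Set X, IsCompact K ∧ ∀ μ ∈ S, μ (cthickening δ K)ᶜ ≤ η) :
    IsTightMeasureSet S := by
  rw [isTightMeasureSet_iff_exists_isCompact_measure_compl_le]
  intro ε hε
  obtain ⟨η, hη, hsum⟩ := ENNReal.exists_pos_sum_of_countable' hε.ne' ℕ
  choose K hK hKS using fun m : ℕ => hS (1 / ((m : ℝ) + 1)) (by positivity) (η m) (hη m)
  refine ⟨_, isCompact_iInter_cthickening hK tendsto_one_div_add_atTop_nhds_zero_nat,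
    fun μ hμ => ?_⟩
  rw [compl_iInter]
  exact (measure_iUnion_le _).trans ((ENNReal.tsum_le_tsum fun m => hKS m μ hμ).trans hsum.le)

theorem measureReal_le_integral_thickenedIndicator {X : Type*} [MetricSpace X]
    [MeasurableSpace X] [BorelSpace X] (μ : Measure X) [IsFiniteMeasure μ]
    {δ : ℝ} (hδ : 0 < δ) {K : Set X} (hK : MeasurableSet K) :
    μ.real K ≤ ∫ x, (thickenedIndicator hδ K x : ℝ) ∂μ := by
  rw [← integral_indicator_one hK]
  refine integral_mono ((integrable_const 1).indicator hK)
    (BoundedContinuousFunction.integrable_of_nnreal _ _) fun x => ?_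
  by_cases hx : x ∈ K
  · simp [hx, thickenedIndicator_one hδ K hx]
  · simp [hx]

theorem integral_thickenedIndicator_le_measureReal {X : Type*} [MetricSpace X]
    [MeasurableSpace X] [BorelSpace X] (μ : Measure X) [IsFiniteMeasure μ]
    {δ : ℝ} (hδ : 0 < δ) (K : Set X) :
    ∫ x, (thickenedIndicator hδ K x : ℝ) ∂μ ≤ μ.real (thickening δ K) := by
  have hm : MeasurableSet (thickening δ K) := isOpen_thickening.measurableSet
  rw [← integral_indicator_one hm]
  refine integral_mono (BoundedContinuousFunction.integrable_of_nnreal _ _)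
    ((integrable_const 1).indicator hm) fun x => ?_
  by_cases hx : x ∈ thickening δ K
  · simpa [hx] using thickenedIndicator_le_one hδ K x
  · simp [hx, thickenedIndicator_zero hδ K hx]

theorem eventually_measure_compl_thickening_le {H : Type*} [MetricSpace H]
    [MeasurableSpace H] [BorelSpace H] {P Q : ℕ → Measure H}
    [∀ n, IsProbabilityMeasure (P n)] [∀ n, IsProbabilityMeasure (Q n)]
    (h : ∀ f : H → ℝ, UniformContinuous f → (∃ C : ℝ, ∀ x, |f x| ≤ C) →
      Tendsto (fun n => (∫ x, f x ∂(P n)) - ∫ x, f x ∂(Q n)) atTop (𝓝 0))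
    {K : Set H} (hK : IsCompact K) {η : ℝ} (hη : 0 < η)
    (hQ : ∀ n, 1 - ENNReal.ofReal η ≤ Q n K) {δ : ℝ} (hδ : 0 < δ) :
    ∀ᶠ n in atTop, P n (thickening δ K)ᶜ ≤ ENNReal.ofReal (2 * η) := by
  have hlim := h (fun x => (thickenedIndicator hδ K x : ℝ))
    (NNReal.isometry_coe.uniformContinuous.comp (lipschitzWith_thickenedIndicator hδ K).uniformContinuous)
    ⟨1, fun x => by simpa using thickenedIndicator_le_one hδ K x⟩
  filter_upwards [hlim.eventually (lt_mem_nhds (neg_lt_zero.2 hη))] with n hn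
  have hQK : 1 - η ≤ (Q n).real K := by
    have h1 : (1 : ENNReal) ≤ Q n K + ENNReal.ofReal η := tsub_le_iff_right.1 (hQ n)
    rw [← ofReal_measureReal, ← ENNReal.ofReal_add measureReal_nonneg hη.le,
      ENNReal.one_le_ofReal] at h1
    linarith
  have hle := measureReal_le_integral_thickenedIndicator (Q n) hδ hK.measurableSet
  have hge := integral_thickenedIndicator_le_measureReal (P n) hδ K
  rw [← ofReal_measureReal, probReal_compl_eq_one_sub isOpen_thickening.measurableSet]
  exact ENNReal.ofReal_le_ofReal (by linarith)

/-- **Remark 2.** If `∫ f dPₙ − ∫ f dQₙ → 0` for every bounded uniformly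
continuous `f : H → ℝ` and the sequence `{Qₙ}` is tight, then `{Pₙ}` is tight. -/
theorem tight_of_weak_uc_convergence_of_tight
    {H : Type*} [MetricSpace H] [CompleteSpace H] [TopologicalSpace.SeparableSpace H]
    [MeasurableSpace H] [BorelSpace H]
    (P Q : ℕ → Measure H)
    [∀ n, IsProbabilityMeasure (P n)] [∀ n, IsProbabilityMeasure (Q n)]
    (h : ∀ f : H → ℝ, UniformContinuous f → (∃ C : ℝ, ∀ x, |f x| ≤ C) →
      Tendsto (fun n => (∫ x, f x ∂(P n)) - ∫ x, f x ∂(Q n)) atTop (𝓝 0))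
    (htight : ∀ ε : ℝ, 0 < ε →
      ∃ K : Set H, IsCompact K ∧ ∀ n, 1 - ENNReal.ofReal ε ≤ Q n K) :
    ∀ ε : ℝ, 0 < ε →
      ∃ K : Set H, IsCompact K ∧ ∀ n, 1 - ENNReal.ofReal ε ≤ P n K := by
  have := UniformSpace.secondCountable_of_separable H
  have hP : IsTightMeasureSet (range P) := by
    refine isTightMeasureSet_of_forall_cthickening fun δ hδ η hη => ?_
    obtain ⟨r, hr, hrη⟩ := ENNReal.lt_iff_exists_nnreal_btwn.1 hη
    have hr0 : (0 : ℝ) < r := by exact_mod_cast hr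
    obtain ⟨K, hK, hQK⟩ := htight (r / 2) (half_pos hr0)
    obtain ⟨N, hN⟩ := eventually_atTop.1
      (eventually_measure_compl_thickening_le h hK (half_pos hr0) hQK hδ)
    choose L hL hPL using fun n =>
      isTightMeasureSet_iff_exists_isCompact_measure_compl_le.1
        (isTightMeasureSet_singleton (μ := P n)) η hη
    refine ⟨K ∪ ⋃ n ∈ Finset.range N, L n,
      hK.union ((Finset.range N).isCompact_biUnion fun n _ => hL n), ?_⟩
    rintro _ ⟨n, rfl⟩
    rcases le_or_gt N n with hn | hn
    · calc P n (cthickening δ (K ∪ ⋃ n ∈ Finset.range N, L n))ᶜ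
          ≤ P n (thickening δ K)ᶜ := by
            gcongr
            exact (thickening_subset_cthickening δ K).trans
              (cthickening_subset_of_subset δ subset_union_left)
        _ ≤ ENNReal.ofReal (2 * (r / 2)) := hN n hn
        _ = r := by rw [mul_div_cancel₀ _ two_ne_zero, ENNReal.ofReal_coe_nnreal]
        _ ≤ η := hrη.le
    · refine (measure_mono (compl_subset_compl.2 ?_)).trans (hPL n (P n) rfl)
      exact (subset_biUnion_of_mem (u := L) (Finset.mem_coe.2 (Finset.mem_range.2 hn))).trans
        (subset_union_right.trans (self_subset_cthickening _))
  intro ε hε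
  obtain ⟨K, hK, hPK⟩ := isTightMeasureSet_iff_exists_isCompact_measure_compl_le.1 hP
    (ENNReal.ofReal ε) (ENNReal.ofReal_pos.2 hε)
  refine ⟨K, hK, fun n => tsub_le_iff_right.2 ?_⟩
  rw [← prob_add_prob_compl (μ := P n) hK.measurableSet]
  gcongr
  exact hPK _ (mem_range_self n)
end

section
/- Let (H, ρ) be a complete separable metric space and let {P_n}, {Q_n} be sequences of Borel probability measures on H. Suppose ∫ f dP_n − ∫ f dQ_n → 0 for every bounded uniformly continuous function f : H → ℝ, and suppose the sequence {Q_n} is tight (for every ε > 0 there is a compact set K with Q_n(K) ≥ 1 − ε for all n). Then ∫ f dP_n − ∫ f dQ_n → 0 for every bounded continuous function f : H → ℝ. -/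
open MeasureTheory Filter Topology Metric Set

/-- A bounded continuous function is minorized by a bounded uniformly continuous one which is
uniformly close to it on a given compact set. -/
theorem exists_uniformContinuous_le_of_isCompact {X : Type*} [PseudoMetricSpace X]
    {f : X → ℝ} (hf : Continuous f) {C : ℝ} (hC : 0 < C) (hfC : ∀ x, |f x| ≤ C)
    {K : Set X} (hK : IsCompact K) {ε : ℝ} (hε : 0 < ε) :
    ∃ g : X → ℝ, UniformContinuous g ∧ (∀ x, |g x| ≤ C) ∧ (∀ x, g x ≤ f x) ∧
      ∀ x ∈ K, f x - ε ≤ g x := by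
  obtain ⟨δ, hδ, hfδ⟩ : ∃ δ > 0, ∀ x ∈ K, ∀ y, dist x y < δ → dist (f x) (f y) < ε := by
    have hmem := hK.uniformContinuousAt_of_continuousAt f (fun x _ => hf.continuousAt)
      (Metric.dist_mem_uniformity hε)
    obtain ⟨δ, hδ, hsub⟩ := Metric.mem_uniformity_dist.1 hmem
    exact ⟨δ, hδ, fun x hx y hxy => hsub hxy hx⟩
  set k : ℝ := 2 * C / δ with hk
  have hk0 : 0 ≤ k := by positivity
  have hlow : ∀ x y, -C ≤ f y + k * dist x y := fun x y => by
    have := neg_le_of_abs_le (hfC y)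
    have : 0 ≤ k * dist x y := by positivity
    linarith
  have hbdd : ∀ x, BddBelow (range fun y => f y + k * dist x y) := fun x =>
    ⟨-C, by rintro _ ⟨y, rfl⟩; exact hlow x y⟩
  have hle : ∀ x, ⨅ y, (f y + k * dist x y) ≤ f x := fun x => by
    simpa using ciInf_le (hbdd x) x
  refine ⟨fun x => ⨅ y, (f y + k * dist x y), ?_, fun x => ?_, hle, fun x hx => ?_⟩
  · refine (LipschitzWith.of_le_add_mul k.toNNReal fun x y => ?_).uniformContinuous
    have : Nonempty X := ⟨x⟩
    rw [Real.coe_toNNReal k hk0, ← sub_le_iff_le_add]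
    refine le_ciInf fun z => ?_
    have h₁ := ciInf_le (hbdd x) z
    have h₂ := mul_le_mul_of_nonneg_left (dist_triangle x y z) hk0
    linarith
  · have : Nonempty X := ⟨x⟩
    exact abs_le.2 ⟨le_ciInf (hlow x), (hle x).trans (le_of_abs_le (hfC x))⟩
  · have : Nonempty X := ⟨x⟩
    refine le_ciInf fun y => ?_
    rcases lt_or_ge (dist x y) δ with hxy | hxy
    · have h₁ := (abs_lt.1 (hfδ x hx y hxy)).2
      have : 0 ≤ k * dist x y := by positivity
      linarith
    · have h₁ : 2 * C ≤ k * dist x y := by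
        calc 2 * C = k * δ := by rw [hk]; field_simp
          _ ≤ k * dist x y := by gcongr
      have h₂ := le_of_abs_le (hfC x)
      have h₃ := neg_le_of_abs_le (hfC y)
      linarith

/-- If a function is at most `ε` on a set `K` and at most `C` everywhere, its integral against a
probability measure giving mass at least `1 - ε` to `K` is at most `ε + C * ε`. -/
theorem integral_le_of_le_on_of_one_sub_le_measure {X : Type*} [MeasurableSpace X]
    {μ : Measure X} [IsProbabilityMeasure μ] {u : X → ℝ} (hu : Integrable u μ) {K : Set X}
    (hK : MeasurableSet K) {ε C : ℝ} (hε : 0 ≤ ε) (hC : 0 ≤ C) (huK : ∀ x ∈ K, u x ≤ ε)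
    (huC : ∀ x, u x ≤ C) (hμK : 1 - ENNReal.ofReal ε ≤ μ K) :
    ∫ x, u x ∂μ ≤ ε + C * ε := by
  have hcompl : μ.real Kᶜ ≤ ε := by
    refine ENNReal.toReal_le_of_le_ofReal hε ?_
    rw [prob_compl_eq_one_sub hK]
    exact tsub_le_iff_tsub_le.1 hμK
  have hInt : Integrable (Kᶜ.indicator fun _ => C) μ :=
    (integrable_const C).indicator hK.compl
  calc ∫ x, u x ∂μ ≤ ∫ x, (ε + Kᶜ.indicator (fun _ => C) x) ∂μ := by
        refine integral_mono hu ((integrable_const ε).add hInt) fun x => ?_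
        by_cases hx : x ∈ K
        · simpa [hx] using huK x hx
        · simpa [hx] using (huC x).trans (le_add_of_nonneg_left hε)
    _ = ε + μ.real Kᶜ * C := by
        rw [integral_add (integrable_const ε) hInt, integral_indicator_const _ hK.compl]
        simp
    _ ≤ ε + C * ε := by
        rw [mul_comm]
        gcongr

/-- Under tightness of the second sequence, merging against bounded uniformly continuous functions
gives an asymptotic lower bound for the difference of integrals of a bounded continuous function. -/
theorem eventually_neg_lt_integral_sub_integral_of_tight
    {H : Type*} [MetricSpace H] [MeasurableSpace H] [BorelSpace H]
    (P Q : ℕ → Measure H)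
    [∀ n, IsProbabilityMeasure (P n)] [∀ n, IsProbabilityMeasure (Q n)]
    (h : ∀ f : H → ℝ, UniformContinuous f → (∃ C : ℝ, ∀ x, |f x| ≤ C) →
      Tendsto (fun n => (∫ x, f x ∂(P n)) - ∫ x, f x ∂(Q n)) atTop (𝓝 0))
    (htight : ∀ ε : ℝ, 0 < ε →
      ∃ K : Set H, IsCompact K ∧ ∀ n, 1 - ENNReal.ofReal ε ≤ Q n K)
    {f : H → ℝ} (hf : Continuous f) {C : ℝ} (hC : 0 < C) (hfC : ∀ x, |f x| ≤ C)
    {η : ℝ} (hη : 0 < η) :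
    ∀ᶠ n in atTop, -η < (∫ x, f x ∂(P n)) - ∫ x, f x ∂(Q n) := by
  set ε : ℝ := η / (2 * (1 + 2 * C)) with hεdef
  have hε : 0 < ε := by positivity
  have hεη : ε + 2 * C * ε = η / 2 := by rw [hεdef]; field_simp
  obtain ⟨K, hK, hQK⟩ := htight ε hε
  obtain ⟨g, hg, hgC, hgf, hgK⟩ := exists_uniformContinuous_le_of_isCompact hf hC hfC hK hε
  have hInt : ∀ (μ : Measure H) [IsProbabilityMeasure μ] (u : H → ℝ), Continuous u →
      (∀ x, |u x| ≤ C) → Integrable u μ := fun μ _ u hu huC =>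
    Integrable.of_bound hu.measurable.aestronglyMeasurable C (.of_forall huC)
  filter_upwards [(h g hg ⟨C, hgC⟩).eventually (lt_mem_nhds (by linarith : -(η / 2) < 0))]
    with n hn
  have hP : ∫ x, g x ∂(P n) ≤ ∫ x, f x ∂(P n) :=
    integral_mono (hInt _ g hg.continuous hgC) (hInt _ f hf hfC) hgf
  have hfQ := hInt (Q n) f hf hfC
  have hgQ := hInt (Q n) g hg.continuous hgC
  have hQ : ∫ x, (f x - g x) ∂(Q n) ≤ ε + 2 * C * ε :=
    integral_le_of_le_on_of_one_sub_le_measure (u := fun x => f x - g x) (hfQ.sub hgQ)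
      hK.measurableSet hε.le (by positivity) (fun x hx => by linarith [hgK x hx])
      (fun x => by linarith [le_of_abs_le (hfC x), neg_le_of_abs_le (hgC x)]) (hQK n)
  rw [integral_sub hfQ hgQ] at hQ
  linarith

/-- **Remark 2.** If `∫ f dPₙ − ∫ f dQₙ → 0` for every bounded uniformly
continuous `f : H → ℝ` and the sequence `{Qₙ}` is tight, then in fact
`∫ f dPₙ − ∫ f dQₙ → 0` for every bounded continuous `f : H → ℝ`. -/
theorem weak_convergence_continuous_of_weak_uc_convergence_of_tight
    {H : Type*} [MetricSpace H] [CompleteSpace H] [TopologicalSpace.SeparableSpace H]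
    [MeasurableSpace H] [BorelSpace H]
    (P Q : ℕ → Measure H)
    [∀ n, IsProbabilityMeasure (P n)] [∀ n, IsProbabilityMeasure (Q n)]
    (h : ∀ f : H → ℝ, UniformContinuous f → (∃ C : ℝ, ∀ x, |f x| ≤ C) →
      Tendsto (fun n => (∫ x, f x ∂(P n)) - ∫ x, f x ∂(Q n)) atTop (𝓝 0))
    (htight : ∀ ε : ℝ, 0 < ε →
      ∃ K : Set H, IsCompact K ∧ ∀ n, 1 - ENNReal.ofReal ε ≤ Q n K) :
    ∀ f : H → ℝ, Continuous f → (∃ C : ℝ, ∀ x, |f x| ≤ C) →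
      Tendsto (fun n => (∫ x, f x ∂(P n)) - ∫ x, f x ∂(Q n)) atTop (𝓝 0) := by
  rintro f hf ⟨C, hfC⟩
  have hC : 0 < |C| + 1 := by positivity
  have hfC' : ∀ x, |f x| ≤ |C| + 1 := fun x => by linarith [hfC x, le_abs_self C]
  rw [Metric.tendsto_nhds]
  intro η hη
  filter_upwards [eventually_neg_lt_integral_sub_integral_of_tight P Q h htight hf hC hfC' hη,
    eventually_neg_lt_integral_sub_integral_of_tight P Q h htight hf.neg hC
      (fun x => by simpa using hfC' x) hη] with n h₁ h₂
  simp only [Pi.neg_apply, integral_neg] at h₂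
  rw [Real.dist_eq, sub_zero, abs_lt]
  constructor <;> linarith
end
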